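/- Suppose T : Ω → closure(Ω) satisfies hypotheses (H0)–(H5). If h ∈ L¹(Ω, m) with h ≥ 0 and ∫_Ω h dm = 1 is such that the measure with density h is T-invariant (i.e. ∫_Ω (φ ∘ T) h dm = ∫_Ω φ h dm for every φ ∈ L∞(Ω, m)), then h coincides m-almost everywhere with a function in BV(Ω). -/

import Mathlib

open MeasureTheory Set Filter Topology
open scoped ENNReal NNReal Classical

noncomputable section

namespace Liverani

/-- The divergence of a vector field on `ℝ^d`. -/
def divg {d : ℕ} (φ : (Fin d → ℝ) → (Fin d → ℝ)) (x : Fin d → ℝ) : ℝ :=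
  ∑ j, fderiv ℝ φ x (Pi.single j 1) j

/-- Test vector fields: `C¹`, compactly supported, sup-norm `≤ 1`. -/
def IsTest (d : ℕ) (φ : (Fin d → ℝ) → (Fin d → ℝ)) : Prop :=
  ContDiff ℝ 1 φ ∧ HasCompactSupport φ ∧ ∀ x, ‖φ x‖ ≤ 1

/-- The BV seminorm on `ℝ^d`, extended-real valued. -/
def bvNormE {d : ℕ} (h : (Fin d → ℝ) → ℝ) : ℝ≥0∞ :=
  ⨆ φ : {φ : (Fin d → ℝ) → (Fin d → ℝ) // IsTest d φ},
    ENNReal.ofReal (∫ x, h x * divg φ.1 x)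

/-- The BV seminorm, real valued. -/
def bvNorm {d : ℕ} (h : (Fin d → ℝ) → ℝ) : ℝ := (bvNormE h).toReal

/-- Membership in `BV(ℝ^d)`. -/
def MemBV {d : ℕ} (h : (Fin d → ℝ) → ℝ) : Prop :=
  Integrable h volume ∧ bvNormE h < ⊤

/-- The BV seminorm on a set `Ω` (of the extension of `h` by zero), extended-real valued. -/
def bvNormOnE {d : ℕ} (Ω : Set (Fin d → ℝ)) (h : (Fin d → ℝ) → ℝ) : ℝ≥0∞ :=
  bvNormE (Ω.indicator h)

/-- The BV norm on a set `Ω`. -/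
def bvNormOn {d : ℕ} (Ω : Set (Fin d → ℝ)) (h : (Fin d → ℝ) → ℝ) : ℝ :=
  bvNorm (Ω.indicator h)

/-- Membership in `BV(Ω)`: the extension by zero belongs to `BV(ℝ^d)`. -/
def MemBVOn {d : ℕ} (Ω : Set (Fin d → ℝ)) (h : (Fin d → ℝ) → ℝ) : Prop :=
  MemBV (Ω.indicator h)

/-- One-dimensional BV seminorm (for slices). -/
def bvNorm1E (g : ℝ → ℝ) : ℝ≥0∞ :=
  ⨆ φ : {φ : ℝ → ℝ // ContDiff ℝ 1 φ ∧ HasCompactSupport φ ∧ ∀ y, |φ y| ≤ 1},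
    ENNReal.ofReal (∫ y, g y * deriv φ.1 y)

/-- The matrix norm `‖A‖_∞ = max_i Σ_j |A i j|`. -/
def matNorm {d : ℕ} (A : Matrix (Fin d) (Fin d) ℝ) : ℝ :=
  NNReal.toReal (Finset.univ.sup fun i => ∑ j, ‖A i j‖₊)

/-- The Jacobian matrix `DT` of a map `T` computed via `fderiv`. -/
def jac {d : ℕ} (T : (Fin d → ℝ) → (Fin d → ℝ)) (x : Fin d → ℝ) :
    Matrix (Fin d) (Fin d) ℝ :=
  Matrix.of fun i j => fderiv ℝ T x (Pi.single j 1) i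

/-- The inverse Jacobian matrix `(DT)⁻¹`. -/
def jacInv {d : ℕ} (T : (Fin d → ℝ) → (Fin d → ℝ)) (x : Fin d → ℝ) :
    Matrix (Fin d) (Fin d) ℝ :=
  (jac T x)⁻¹

/-- Entrywise partial derivative `∂_{x_j} (DT)⁻¹` of the inverse Jacobian along the
`j`-th coordinate. -/
def jacDj {d : ℕ} (T : (Fin d → ℝ) → (Fin d → ℝ)) (j : Fin d) (z : Fin d → ℝ) :
    Matrix (Fin d) (Fin d) ℝ :=
  Matrix.of fun i i' => deriv (fun y => jacInv T (Function.update z j y) i i') (z j)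

/-- The transfer operator `(L h)(x) = Σ_{y ∈ Ω ∩ T⁻¹{x}} |det D_y T|⁻¹ h(y)`. -/
def transferOp {d : ℕ} (Ω : Set (Fin d → ℝ)) (T : (Fin d → ℝ) → (Fin d → ℝ))
    (h : (Fin d → ℝ) → ℝ) (x : Fin d → ℝ) : ℝ :=
  ∑' y : ↥(Ω ∩ T ⁻¹' {x}), |(jac T y).det|⁻¹ * h y

/-- `Ω_k^ε`, the part of `U` at distance at least `ε` from its boundary. -/
def innerPart {d : ℕ} (U : Set (Fin d → ℝ)) (ε : ℝ) : Set (Fin d → ℝ) :=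
  {x ∈ U | ε ≤ Metric.infDist x (frontier U)}

/-- `∂^ε Ω_k`, the `ε`-boundary layer of `U`. -/
def bLayer {d : ℕ} (U : Set (Fin d → ℝ)) (ε : ℝ) : Set (Fin d → ℝ) :=
  U \ innerPart U ε

/-- `Γ_ε = ∪_k ∂^ε Ω_k`. -/
def Gam {d : ℕ} (parts : ℕ → Set (Fin d → ℝ)) (ε : ℝ) : Set (Fin d → ℝ) :=
  ⋃ k, bLayer (parts k) ε

/-- A piecewise expanding system: the data `Ω, T, {Ω_k}, {I_{k,ℓ}}, δ, λ` together with
hypotheses (H0)–(H5). -/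
structure PES (d : ℕ) where
  Ω : Set (Fin d → ℝ)
  T : (Fin d → ℝ) → (Fin d → ℝ)
  parts : ℕ → Set (Fin d → ℝ)
  Ifam : Fin d → (Fin d → ℝ) → ℕ → ℕ → Set ℝ
  δ : ℝ
  lam : ℝ
  Ω_open : IsOpen Ω
  Ω_subset : Ω ⊆ Set.Icc 0 1
  T_maps : Set.MapsTo T Ω (closure Ω)
  /-- (H0) -/
  h0 : ∀ n : ℕ, volume (T^[n] ⁻¹' frontier Ω) = 0
  /-- (H1) -/
  parts_open : ∀ k, IsOpen (parts k)
  parts_conn : ∀ k, IsPreconnected (parts k)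
  parts_disj : Pairwise (Function.onFun Disjoint parts)
  parts_union : ⋃ k, parts k = Ω
  T_C2 : ∀ k, ContDiffOn ℝ 2 T (parts k)
  T_inv : ∀ k, ∃ S : (Fin d → ℝ) → (Fin d → ℝ),
    ContDiffOn ℝ 1 S (T '' parts k) ∧ ∀ x ∈ parts k, S (T x) = x
  /-- (H2): continuous extension of `T` to the closure of each `Ω_k` -/
  h2T : ∀ k, ∃ g : (Fin d → ℝ) → (Fin d → ℝ),
    ContinuousOn g (closure (parts k)) ∧ Set.EqOn g T (parts k)
  /-- (H2): continuous extension of `(DT)⁻¹` to the closure of each `Ω_k` -/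
  h2D : ∀ k, ∃ G : (Fin d → ℝ) → Matrix (Fin d) (Fin d) ℝ,
    ContinuousOn G (closure (parts k)) ∧ Set.EqOn G (jacInv T) (parts k)
  /-- (H3): the slice structure -/
  δ_pos : 0 < δ
  lam_gt_one : 1 < lam
  Ifam_indep : ∀ (j : Fin d) (x x' : Fin d → ℝ) (k ℓ : ℕ),
    (∀ i, i ≠ j → x i = x' i) → Ifam j x k ℓ = Ifam j x' k ℓ
  Ifam_open : ∀ j x k ℓ, IsOpen (Ifam j x k ℓ)
  Ifam_conn : ∀ j x k ℓ, IsPreconnected (Ifam j x k ℓ)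
  Ifam_disj : ∀ j x k, Pairwise (Function.onFun Disjoint (Ifam j x k))
  Ifam_union : ∀ j x k, {y : ℝ | Function.update x j y ∈ parts k} = ⋃ ℓ, Ifam j x k ℓ
  h3 : ∀ x ∈ Set.Icc (0 : Fin d → ℝ) 1, ∀ j : Fin d,
    (∑' p : ℕ × ℕ,
      if (Set.Icc (x j - δ) (x j + δ) ∩ Ifam j x p.1 p.2).Nonempty then
        ⨆ y ∈ Ifam j x p.1 p.2,
          ENNReal.ofReal (matNorm (jacInv T (Function.update x j y)))
      else 0) ≤ ENNReal.ofReal lam⁻¹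
  /-- (H4) -/
  h4 : ∀ j : Fin d,
    Filter.Tendsto (fun ε : ℝ =>
      ⨆ x : Fin d → ℝ, ∑' k : ℕ, ∫⁻ y in Set.Icc (0:ℝ) 1,
        Set.indicator (bLayer (parts k) ε)
          (fun z => ENNReal.ofReal (matNorm (jacDj T j z)))
          (Function.update x j y))
      (nhdsWithin 0 (Set.Ioi 0)) (nhds 0)
  /-- (H5) -/
  h5 : ∀ i j k : Fin d,
    MeasureTheory.IntegrableOn (fun x => jac T x k j * jacInv T x j i) Ω volume

/-- A piecewise expanding system satisfying in addition hypothesis (H6). -/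
structure PES6 (d : ℕ) extends PES d where
  Cb : ℝ
  αb : ℝ
  ab : ℝ
  Cb_pos : 0 < Cb
  αb_mem : αb ∈ Set.Ioc (0:ℝ) 1
  ab_ge_one : 1 ≤ ab
  /-- (H6): measure of the boundary layers -/
  h6a : ∀ ε : ℝ, 0 < ε →
    volume (⋃ k, bLayer (parts k) ε) ≤ ENNReal.ofReal (Cb ^ d * ε ^ αb)
  /-- (H6): blow-up of `∇ det DT` near the singularities -/
  h6b : ∀ x ∈ Ω, ∀ i : Fin d,
    |fderiv ℝ (fun z => (jac T z).det) x (Pi.single i 1)| ≤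
      Cb * Metric.infDist x (frontier Ω) ^ (-ab)

/-- `μ` is a `T`-invariant probability measure, absolutely continuous w.r.t. Lebesgue,
supported in `Ω`. -/
def InvariantMeasure {d : ℕ} (Ω : Set (Fin d → ℝ)) (T : (Fin d → ℝ) → (Fin d → ℝ))
    (μ : Measure (Fin d → ℝ)) : Prop :=
  IsProbabilityMeasure μ ∧ μ ≪ volume ∧ μ Ωᶜ = 0 ∧
    ∀ A : Set (Fin d → ℝ), MeasurableSet A → μ (T ⁻¹' A) = μ A

/-- `μ` is an ergodic absolutely continuous invariant probability measure. -/
def ErgodicACIM {d : ℕ} (Ω : Set (Fin d → ℝ)) (T : (Fin d → ℝ) → (Fin d → ℝ))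
    (μ : Measure (Fin d → ℝ)) : Prop :=
  InvariantMeasure Ω T μ ∧
    ∀ A : Set (Fin d → ℝ), MeasurableSet A → T ⁻¹' A = A → μ A = 0 ∨ μ A = 1

/-- `h` is a density of `μ` with respect to Lebesgue measure. -/
def IsDensity {d : ℕ} (μ : Measure (Fin d → ℝ)) (h : (Fin d → ℝ) → ℝ) : Prop :=
  ∀ A : Set (Fin d → ℝ), MeasurableSet A → μ A = ∫⁻ x in A, ENNReal.ofReal (h x) ∂volume

/-- The system `(T, μ)` is mixing. -/
def Mixing {d : ℕ} (T : (Fin d → ℝ) → (Fin d → ℝ)) (μ : Measure (Fin d → ℝ)) : Prop :=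
  ∀ A B : Set (Fin d → ℝ), MeasurableSet A → MeasurableSet B →
    Tendsto (fun n : ℕ => μ (T^[n] ⁻¹' A ∩ B)) atTop (𝓝 (μ A * μ B))

/-- A one-dimensional mollifier. -/
def IsMollifier (η : ℝ → ℝ) : Prop :=
  ContDiff ℝ (⊤ : ℕ∞) η ∧ (∀ y, 0 ≤ η y) ∧ Function.support η ⊆ Set.Icc (-1) 1 ∧ ∫ y, η y = 1

/-- The product mollifier `η̄_δ(x) = δ^{-d} Π_i η(δ⁻¹ x_i)`. -/
def moll (d : ℕ) (η : ℝ → ℝ) (δ : ℝ) (x : Fin d → ℝ) : ℝ :=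
  (δ ^ d)⁻¹ * ∏ i, η (δ⁻¹ * x i)

/-- The regularization `h_δ(x) = ∫_Ω η̄_δ(x-y) h(y) dy + δ`. -/
def mollify (d : ℕ) (η : ℝ → ℝ) (Ω : Set (Fin d → ℝ)) (h : (Fin d → ℝ) → ℝ)
    (δ : ℝ) (x : Fin d → ℝ) : ℝ :=
  (∫ y in Ω, moll d η δ (x - y) * h y) + δ

/-- `ν₀ = ‖(DT)⁻¹‖_{L∞(Ω)}`. -/
def nu0 {d : ℕ} (Ω : Set (Fin d → ℝ)) (T : (Fin d → ℝ) → (Fin d → ℝ)) : ℝ :=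
  (essSup (fun x => ENNReal.ofReal (matNorm (jacInv T x))) (volume.restrict Ω)).toReal

/-- The truncated ("open") transfer operators
`L̃_{ε,n} = L_{ε,0} ⋯ L_{ε,n-1}` where `L_{ε,k} f = L((1 - 1_{Γ_{ε ν^k}}) f)`. -/
def tildeOp {d : ℕ} (Ω : Set (Fin d → ℝ)) (T : (Fin d → ℝ) → (Fin d → ℝ))
    (parts : ℕ → Set (Fin d → ℝ)) (ν : ℝ) :
    ℕ → ℝ → ((Fin d → ℝ) → ℝ) → (Fin d → ℝ) → ℝ
  | 0, _, f => f
  | n + 1, ε, f => transferOp Ω T (((Gam parts ε)ᶜ).indicator (tildeOp Ω T parts ν n (ε * ν) f))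



/-- The right boundary value of a `C¹` function is controlled on a one-sided neighbourhood. -/
lemma abs_le_integral_right {v : ℝ → ℝ} (hv : ContDiff ℝ 1 v) {δ : ℝ} (hδ : 0 < δ) (b : ℝ) :
    |v b| ≤ ∫ y in b..b + δ, (|deriv v y| + δ⁻¹ * |v y|) := by
  have hv' : Continuous (deriv v) := hv.continuous_deriv le_rfl
  have hvc : Continuous v := hv.continuous
  have hd : ∀ y, HasDerivAt v (deriv v y) y := fun y =>
    ((hv.differentiable one_ne_zero) y).hasDerivAt
  have key : ∫ y in b..b + δ, (deriv v y * (1 - δ⁻¹ * (y - b)) - δ⁻¹ * v y) = - v b := by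
    have := intervalIntegral.integral_eq_sub_of_hasDerivAt
      (f := fun y => v y * (1 - δ⁻¹ * (y - b)))
      (f' := fun y => deriv v y * (1 - δ⁻¹ * (y - b)) - δ⁻¹ * v y) (a := b) (b := b + δ) ?_ ?_
    · rw [this]; field_simp; simp [mul_comm]
    · intro y _
      have h1 : HasDerivAt (fun y : ℝ => 1 - δ⁻¹ * (y - b)) (-δ⁻¹) y := by
        have := (((hasDerivAt_id y).sub_const b).const_mul δ⁻¹).const_sub 1
        simpa using this
      exact ((hd y).mul h1).congr_deriv (by ring)
    · exact Continuous.intervalIntegrable (by fun_prop) _ _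
  rw [← abs_neg, ← key]
  refine (intervalIntegral.abs_integral_le_integral_abs (by linarith)).trans ?_
  refine intervalIntegral.integral_mono_on (by linarith)
    (Continuous.intervalIntegrable (by fun_prop) _ _)
    (Continuous.intervalIntegrable (by fun_prop) _ _) fun y hy => ?_
  have h1 : |1 - δ⁻¹ * (y - b)| ≤ 1 := by
    have h2 : 0 ≤ δ⁻¹ * (y - b) := mul_nonneg (by positivity) (by linarith [hy.1])
    have h3 : δ⁻¹ * (y - b) ≤ 1 := by
      rw [inv_mul_le_iff₀ hδ]; linarith [hy.2]
    rw [abs_le]; constructor <;> linarith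
  calc |deriv v y * (1 - δ⁻¹ * (y - b)) - δ⁻¹ * v y|
      ≤ |deriv v y * (1 - δ⁻¹ * (y - b))| + |δ⁻¹ * v y| := abs_sub _ _
    _ ≤ |deriv v y| + δ⁻¹ * |v y| := by
        rw [abs_mul, abs_mul, abs_of_pos (inv_pos.2 hδ)]
        gcongr
        exact mul_le_of_le_one_right (abs_nonneg _) h1

/-- The left boundary value of a `C¹` function is controlled on a one-sided neighbourhood. -/
lemma abs_le_integral_left {v : ℝ → ℝ} (hv : ContDiff ℝ 1 v) {δ : ℝ} (hδ : 0 < δ) (a : ℝ) :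
    |v a| ≤ ∫ y in a - δ..a, (|deriv v y| + δ⁻¹ * |v y|) := by
  have hw : ContDiff ℝ 1 fun y => v (-y) := hv.comp contDiff_neg
  have := abs_le_integral_right hw hδ (-a)
  have h2 : ∀ y, |deriv (fun y => v (-y)) y| + δ⁻¹ * |v (-y)|
      = (fun y => |deriv v y| + δ⁻¹ * |v y|) (-y) := by
    intro y
    simp [deriv_comp_neg]
  simp only [h2] at this
  rw [intervalIntegral.integral_comp_neg (fun y => |deriv v y| + δ⁻¹ * |v y|)] at this
  simpa [sub_eq_add_neg, add_comm] using this

lemma abs_integral_mul_deriv_le {v ψ ψ' : ℝ → ℝ} (hv : ContDiff ℝ 1 v) {δ : ℝ} (hδ : 0 < δ)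
    {a b M : ℝ} (hab : a ≤ b) (hψ : ∀ y ∈ Icc a b, HasDerivAt ψ (ψ' y) y)
    (hψ' : ContinuousOn ψ' (Icc a b)) (hM : ∀ y ∈ Icc a b, |ψ y| ≤ M) :
    |∫ y in a..b, v y * ψ' y| ≤ M * ∫ y in a - δ..b + δ, (|deriv v y| + δ⁻¹ * |v y|) := by
  have hv' : Continuous (deriv v) := hv.continuous_deriv le_rfl
  have hvc : Continuous v := hv.continuous
  have hM0 : 0 ≤ M := (abs_nonneg _).trans (hM a (left_mem_Icc.2 hab))
  have hgi : ∀ c d, IntervalIntegrable (fun y => |deriv v y| + δ⁻¹ * |v y|) volume c d :=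
    fun c d => Continuous.intervalIntegrable (by fun_prop) _ _
  have hd : ∀ y, HasDerivAt v (deriv v y) y := fun y =>
    ((hv.differentiable one_ne_zero) y).hasDerivAt
  have hibp := intervalIntegral.integral_mul_deriv_eq_deriv_mul (u := v) (v := ψ) (u' := deriv v)
    (v' := ψ') (a := a) (b := b) (fun y _ => hd y) (by rwa [uIcc_of_le hab])
    (hv'.intervalIntegrable _ _) (by
      apply ContinuousOn.intervalIntegrable; rwa [uIcc_of_le hab])
  rw [hibp]
  have h3 : |∫ y in a..b, deriv v y * ψ y| ≤ M * ∫ y in a..b, (|deriv v y| + δ⁻¹ * |v y|) := by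
    rw [← intervalIntegral.integral_const_mul]
    have := intervalIntegral.norm_integral_le_of_norm_le (f := fun y => deriv v y * ψ y)
      (g := fun y => M * (|deriv v y| + δ⁻¹ * |v y|)) (μ := volume) hab ?_
      ((hgi a b).const_mul M)
    · simpa using this
    · filter_upwards with y hy
      have := hM y (Ioc_subset_Icc_self hy)
      rw [Real.norm_eq_abs, abs_mul]
      calc |deriv v y| * |ψ y| ≤ |deriv v y| * M := by gcongr
        _ = M * |deriv v y| := mul_comm _ _
        _ ≤ _ := by
          gcongr
          have : 0 ≤ δ⁻¹ * |v y| := by positivity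
          linarith
  have h1 := abs_le_integral_right hv hδ b
  have h2 := abs_le_integral_left hv hδ a
  have hb1 : |v b * ψ b| ≤ M * |v b| := by
    rw [abs_mul, mul_comm]; gcongr; exact hM b (right_mem_Icc.2 hab)
  have ha1 : |v a * ψ a| ≤ M * |v a| := by
    rw [abs_mul, mul_comm]; gcongr; exact hM a (left_mem_Icc.2 hab)
  rw [← intervalIntegral.integral_add_adjacent_intervals (hgi (a - δ) b) (hgi b _),
    ← intervalIntegral.integral_add_adjacent_intervals (hgi (a - δ) a) (hgi a b), mul_add, mul_add]
  have := mul_le_mul_of_nonneg_left h1 hM0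
  have := mul_le_mul_of_nonneg_left h2 hM0
  have e1 := abs_sub (v b * ψ b - v a * ψ a) (∫ y in a..b, deriv v y * ψ y)
  have e2 := abs_sub (v b * ψ b) (v a * ψ a)
  linarith

/-- Integration by parts against a function bounded by `M` on a bounded open interval `I`,
without boundary terms: the price is an enlargement of the interval. -/
lemma enorm_integral_mul_deriv_le {v ψ ψ' : ℝ → ℝ} (hv : ContDiff ℝ 1 v) {δ : ℝ} (hδ : 0 < δ)
    {I : Set ℝ} {M : ℝ≥0} (hI : IsOpen I) (hIc : IsPreconnected I) (hI01 : I ⊆ Icc 0 1)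
    (hψ : ∀ y ∈ I, HasDerivAt ψ (ψ' y) y)
    (hψ' : ContinuousOn ψ' I) (hM : ∀ y ∈ I, |ψ y| ≤ M)
    (hintegrable : IntegrableOn (fun y => v y * ψ' y) I) :
    ‖∫ y in I, v y * ψ' y‖ₑ ≤
      M * ∫⁻ y in Metric.thickening δ I, (‖deriv v y‖ₑ + ENNReal.ofReal δ⁻¹ * ‖v y‖ₑ) := by
  have hv' : Continuous (deriv v) := hv.continuous_deriv le_rfl
  have hvc : Continuous v := hv.continuous
  rcases I.eq_empty_or_nonempty with rfl | hne
  · simp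
  have hcon : IsConnected I := ⟨hne, hIc⟩
  have hbb : BddBelow I := bddBelow_Icc.mono hI01
  have hba : BddAbove I := bddAbove_Icc.mono hI01
  set A := sInf I
  set B := sSup I
  have hIeq : I = Ioo A B := by
    refine Subset.antisymm (fun y hy => ?_) (hcon.Ioo_csInf_csSup_subset hbb hba)
    obtain ⟨r, hr, hball⟩ := Metric.isOpen_iff.1 hI y hy
    have h1 : y - r / 2 ∈ I := hball (by simp [abs_of_pos hr, hr])
    have h2 : y + r / 2 ∈ I := hball (by simp [abs_of_pos hr, hr])
    exact ⟨lt_of_le_of_lt (csInf_le hbb h1) (by linarith),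
      lt_of_lt_of_le (by linarith) (le_csSup hba h2)⟩
  have hAB : A < B := by
    obtain ⟨y, hy⟩ := hne
    rw [hIeq] at hy; exact hy.1.trans hy.2
  obtain ⟨a, -, ha, hat⟩ := exists_seq_strictAnti_tendsto' hAB
  obtain ⟨b, -, hb, hbt⟩ := exists_seq_strictMono_tendsto' hAB
  have hcov := aecover_Ioo_of_Icc (μ := (volume : Measure ℝ)) hat hbt
  rw [← hIeq] at hcov
  have hlim := (hcov.integral_tendsto_of_countably_generated hintegrable).enorm
  refine le_of_tendsto hlim ?_
  have hev : ∀ᶠ n in atTop, a n ≤ b n := by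
    filter_upwards [hat.eventually_lt hbt hAB] with n hn using hn.le
  filter_upwards [hev] with n hn
  have hsub : Icc (a n) (b n) ⊆ I := by
    rw [hIeq]; intro y hy
    exact ⟨(ha n).1.trans_le hy.1, hy.2.trans_lt (hb n).2⟩
  rw [Measure.restrict_restrict measurableSet_Icc, inter_eq_self_of_subset_left hsub,
    integral_Icc_eq_integral_Ioc, ← intervalIntegral.integral_of_le hn]
  have key := abs_integral_mul_deriv_le hv hδ hn (fun y hy => hψ y (hsub hy)) (hψ'.mono hsub)
    (fun y hy => hM y (hsub hy))
  have hg0 : ∀ y, 0 ≤ |deriv v y| + δ⁻¹ * |v y| := fun y => by positivity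
  have hle : a n - δ ≤ b n + δ := by linarith
  rw [Real.enorm_eq_ofReal_abs]
  refine (ENNReal.ofReal_le_ofReal key).trans ?_
  rw [ENNReal.ofReal_mul M.coe_nonneg, ENNReal.ofReal_coe_nnreal]
  gcongr
  rw [intervalIntegral.integral_of_le hle, integral_Ioc_eq_integral_Ioo,
    ofReal_integral_eq_lintegral_ofReal]
  · have : ∀ y, ENNReal.ofReal (|deriv v y| + δ⁻¹ * |v y|)
        = ‖deriv v y‖ₑ + ENNReal.ofReal δ⁻¹ * ‖v y‖ₑ := fun y => by
      rw [ENNReal.ofReal_add (abs_nonneg _) (by positivity), ENNReal.ofReal_mul (by positivity),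
        ← Real.enorm_eq_ofReal_abs, ← Real.enorm_eq_ofReal_abs]
    simp only [this]
    refine lintegral_mono_set fun y hy => ?_
    rw [Metric.mem_thickening_iff]
    rcases lt_or_ge y (a n) with h | h
    · exact ⟨a n, hsub (left_mem_Icc.2 hn), by
        rw [Real.dist_eq, abs_lt]; constructor <;> linarith [hy.1]⟩
    rcases lt_or_ge (b n) y with h' | h'
    · exact ⟨b n, hsub (right_mem_Icc.2 hn), by
        rw [Real.dist_eq, abs_lt]; constructor <;> linarith [hy.2]⟩
    · exact ⟨y, hsub ⟨h, h'⟩, by simpa using hδ⟩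
  · exact (Continuous.integrableOn_Icc (by fun_prop)).mono_set Ioo_subset_Icc_self
  · exact ae_of_all _ hg0

/-- One-dimensional Lasota–Yorke estimate on a countable union of intervals. -/
lemma enorm_integral_iUnion_le {ι : Type*} [Countable ι] {I : ι → Set ℝ}
    (hI : ∀ p, IsOpen (I p)) (hIc : ∀ p, IsPreconnected (I p)) (hI01 : ∀ p, I p ⊆ Icc 0 1)
    (hdisj : Pairwise (Function.onFun Disjoint I)) {δ : ℝ} (hδ : 0 < δ) {m : ℝ → ℝ≥0∞}
    {Λ : ℝ≥0∞} (hΛ : Λ ≠ ⊤)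
    (h3 : ∀ y ∈ Icc (0 : ℝ) 1, (∑' p, if (Icc (y - δ) (y + δ) ∩ I p).Nonempty then
      ⨆ z ∈ I p, m z else 0) ≤ Λ)
    {v ψ D F : ℝ → ℝ} (hv : ContDiff ℝ 1 v)
    (hψ : ∀ y ∈ ⋃ p, I p, HasDerivAt ψ (D y + F y) y)
    (hD : ContinuousOn D (⋃ p, I p)) (hF : ContinuousOn F (⋃ p, I p))
    (hm : ∀ y ∈ ⋃ p, I p, ‖ψ y‖ₑ ≤ m y) {R : ℝ≥0∞}
    (hR : ∫⁻ y in ⋃ p, I p, ‖v y * F y‖ₑ ≤ R) :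
    ‖∫ y in ⋃ p, I p, v y * D y‖ₑ ≤
      Λ * (∫⁻ y, (‖deriv v y‖ₑ + ENNReal.ofReal δ⁻¹ * ‖v y‖ₑ)) + R := by
  have hvc : Continuous v := hv.continuous
  have hv' : Continuous (deriv v) := hv.continuous_deriv le_rfl
  by_cases hRt : R = ⊤
  · simp [hRt]
  by_cases hintegrable : IntegrableOn (fun y => v y * D y) (⋃ p, I p)
  swap
  · rw [integral_undef hintegrable]; simp
  have hUm : MeasurableSet (⋃ p, I p) := (isOpen_iUnion hI).measurableSet
  have hintF : IntegrableOn (fun y => v y * F y) (⋃ p, I p) :=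
    ⟨(hvc.continuousOn.mul hF).aestronglyMeasurable hUm,
      lt_of_le_of_lt hR (lt_top_iff_ne_top.2 hRt)⟩
  set M : ι → ℝ≥0∞ := fun p => ⨆ z ∈ I p, m z with hMdef
  have hMΛ : ∀ p, M p ≤ Λ := by
    intro p
    refine iSup₂_le fun z hz => ?_
    refine le_trans ?_ (h3 z (hI01 p hz))
    refine le_trans ?_ (ENNReal.le_tsum p)
    rw [if_pos ⟨z, ⟨⟨by linarith, by linarith⟩, hz⟩⟩]
    exact le_iSup₂ (f := fun z (_ : z ∈ I p) => m z) z hz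
  have hMt : ∀ p, M p ≠ ⊤ := fun p => ne_top_of_le_ne_top hΛ (hMΛ p)
  set g : ℝ → ℝ≥0∞ := fun y => ‖deriv v y‖ₑ + ENNReal.ofReal δ⁻¹ * ‖v y‖ₑ with hg
  have hgm : Measurable g := by fun_prop
  have hpiece : ∀ p, ‖∫ y in I p, v y * D y‖ₑ ≤
      (∫⁻ y, (Metric.thickening δ (I p)).indicator (fun _ => M p) y * g y)
        + ∫⁻ y in I p, ‖v y * F y‖ₑ := by
    intro p
    have hsub : I p ⊆ ⋃ p, I p := subset_iUnion I p
    have hDi := hintegrable.mono_set hsub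
    have hFi := hintF.mono_set hsub
    have hDFi : IntegrableOn (fun y => v y * (D y + F y)) (I p) :=
      (hDi.add hFi).congr_fun (fun y _ => (mul_add _ _ _).symm) (hI p).measurableSet
    have h1 : ∫ y in I p, v y * D y =
        (∫ y in I p, v y * (D y + F y)) - ∫ y in I p, v y * F y := by
      rw [← integral_sub _ hFi]
      · congr 1; ext y; ring
      · exact hDFi
    rw [h1]
    refine (enorm_sub_le).trans (add_le_add ?_ (enorm_integral_le_lintegral_enorm _))
    have := enorm_integral_mul_deriv_le (v := v) (ψ := ψ) (ψ' := fun y => D y + F y)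
      (M := (M p).toNNReal) hv hδ (hI p) (hIc p) (hI01 p) (fun y hy => hψ y (hsub hy))
      ((hD.add hF).mono hsub) ?_ ?_
    · refine this.trans (le_of_eq ?_)
      rw [ENNReal.coe_toNNReal (hMt p), ← lintegral_const_mul _ hgm,
        ← lintegral_indicator Metric.isOpen_thickening.measurableSet]
      congr 1; ext y
      simp only [indicator]; split_ifs <;> simp
    · intro y hy
      have h2 : ‖ψ y‖ₑ ≤ M p :=
        (hm y (hsub hy)).trans (le_iSup₂ (f := fun z (_ : z ∈ I p) => m z) y hy)
      have := ENNReal.toReal_mono (hMt p) h2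
      rw [ENNReal.coe_toNNReal_eq_toReal]
      simpa using this
    · exact hDFi
  have hsum : ∫ y in ⋃ p, I p, v y * D y = ∑' p, ∫ y in I p, v y * D y :=
    (hasSum_integral_iUnion (fun p => (hI p).measurableSet) hdisj hintegrable).tsum_eq.symm
  rw [hsum]
  refine enorm_tsum_le_tsum_enorm.trans ?_
  refine (ENNReal.tsum_le_tsum hpiece).trans ?_
  rw [ENNReal.tsum_add, ← lintegral_iUnion (fun p => (hI p).measurableSet) hdisj]
  refine add_le_add ?_ hR
  rw [← lintegral_tsum]
  · rw [← lintegral_const_mul _ hgm]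
    refine lintegral_mono fun y => ?_
    simp only
    rw [ENNReal.tsum_mul_right]
    gcongr
    set c : ℝ := max 0 (min 1 y) with hc
    have hc01 : c ∈ Icc (0 : ℝ) 1 := ⟨le_max_left _ _, max_le zero_le_one (min_le_left _ _)⟩
    refine le_trans (ENNReal.tsum_le_tsum fun p => ?_) (h3 c hc01)
    by_cases hy : y ∈ Metric.thickening δ (I p)
    · rw [indicator_of_mem hy, if_pos]
      obtain ⟨z, hz, hyz⟩ := Metric.mem_thickening_iff.1 hy
      rw [Real.dist_eq, abs_lt] at hyz
      have hz01 := hI01 p hz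
      refine ⟨z, ⟨?_, ?_⟩, hz⟩
      · rcases le_total y 1 with h | h
        · rw [min_eq_right h] at hc
          rcases le_total 0 y with h' | h'
          · rw [max_eq_right h'] at hc; linarith
          · rw [max_eq_left h'] at hc; linarith [hz01.1]
        · rw [min_eq_left h] at hc
          rw [max_eq_right zero_le_one] at hc
          linarith
      · rcases le_total y 1 with h | h
        · have : y ≤ c := by rw [hc, min_eq_right h]; exact le_max_right _ _
          linarith
        · rw [min_eq_left h] at hc
          rw [max_eq_right zero_le_one] at hc
          linarith [hz01.2]
    · rw [indicator_of_notMem hy]; exact zero_le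
  · intro p
    exact ((measurable_const.indicator Metric.isOpen_thickening.measurableSet).mul
      hgm).aemeasurable

lemma sum_abs_le_matNorm {d : ℕ} (A : Matrix (Fin d) (Fin d) ℝ) (i : Fin d) :
    ∑ j, |A i j| ≤ matNorm A := by
  have := Finset.le_sup (f := fun i => ∑ j, ‖A i j‖₊) (Finset.mem_univ i)
  have h2 := NNReal.coe_le_coe.2 this
  push_cast at h2
  simpa [matNorm] using h2

lemma matNorm_le_sum {d : ℕ} (A : Matrix (Fin d) (Fin d) ℝ) :
    matNorm A ≤ ∑ i, ∑ j, |A i j| := by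
  have : (Finset.univ.sup fun i => ∑ j, ‖A i j‖₊) ≤ ∑ i, ∑ j, ‖A i j‖₊ :=
    Finset.sup_le fun i _ => Finset.single_le_sum (f := fun i => ∑ j, ‖A i j‖₊)
      (fun _ _ => zero_le) (Finset.mem_univ i)
  have h2 := NNReal.coe_le_coe.2 this
  push_cast at h2
  simpa [matNorm] using h2

/-- A row of a matrix paired with a vector of sup norm at most one. -/
lemma abs_sum_mul_le_matNorm {d : ℕ} (A : Matrix (Fin d) (Fin d) ℝ) (i : Fin d) {u : Fin d → ℝ}
    (hu : ‖u‖ ≤ 1) : |∑ j, A i j * u j| ≤ matNorm A := by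
  refine (Finset.abs_sum_le_sum_abs _ _).trans (le_trans ?_ (sum_abs_le_matNorm A i))
  refine Finset.sum_le_sum fun j _ => ?_
  rw [abs_mul]
  exact mul_le_of_le_one_right (abs_nonneg _) ((norm_le_pi_norm u j).trans hu)

lemma contDiffOn_det {E : Type*} [NormedAddCommGroup E] [NormedSpace ℝ E] {d : ℕ}
    {n : WithTop ℕ∞} {s : Set E} {A : E → Matrix (Fin d) (Fin d) ℝ}
    (hA : ∀ i j, ContDiffOn ℝ n (fun x => A x i j) s) :
    ContDiffOn ℝ n (fun x => (A x).det) s := by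
  simp only [Matrix.det_apply]
  refine ContDiffOn.sum fun σ _ => ?_
  refine ContDiffOn.const_smul _ ?_
  exact contDiffOn_prod fun i _ => hA _ _

lemma contDiffOn_matrix_inv {E : Type*} [NormedAddCommGroup E] [NormedSpace ℝ E] {d : ℕ}
    {n : WithTop ℕ∞} {s : Set E} {A : E → Matrix (Fin d) (Fin d) ℝ}
    (hA : ∀ i j, ContDiffOn ℝ n (fun x => A x i j) s) (hdet : ∀ x ∈ s, (A x).det ≠ 0)
    (i j : Fin d) : ContDiffOn ℝ n (fun x => (A x)⁻¹ i j) s := by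
  simp only [Matrix.inv_def, Matrix.smul_apply, Ring.inverse_eq_inv', smul_eq_mul,
    Matrix.adjugate_apply]
  refine ((contDiffOn_det hA).inv hdet).mul (contDiffOn_det fun k l => ?_)
  by_cases hk : k = j
  · subst hk
    simp only [Matrix.updateRow_self]
    exact contDiffOn_const
  · simp only [Matrix.updateRow_ne hk]
    exact hA k l

namespace PES

variable {d : ℕ} (S : PES d)

lemma parts_subset (k : ℕ) : S.parts k ⊆ S.Ω := by
  rw [← S.parts_union]; exact subset_iUnion S.parts k

lemma exists_mem_parts {x : Fin d → ℝ} (hx : x ∈ S.Ω) : ∃ k, x ∈ S.parts k := by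
  rw [← S.parts_union] at hx; exact mem_iUnion.1 hx

lemma contDiffAt_T {x : Fin d → ℝ} (hx : x ∈ S.Ω) : ContDiffAt ℝ 2 S.T x := by
  obtain ⟨k, hk⟩ := S.exists_mem_parts hx
  exact (S.T_C2 k).contDiffAt ((S.parts_open k).mem_nhds hk)

lemma contDiffOn_T : ContDiffOn ℝ 2 S.T S.Ω := fun _ hx => (S.contDiffAt_T hx).contDiffWithinAt

lemma differentiableAt_T {x : Fin d → ℝ} (hx : x ∈ S.Ω) : DifferentiableAt ℝ S.T x :=
  (S.contDiffAt_T hx).differentiableAt two_ne_zero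

lemma continuousOn_T : ContinuousOn S.T S.Ω := S.contDiffOn_T.continuousOn

lemma contDiffOn_jac (i j : Fin d) : ContDiffOn ℝ 1 (fun x => jac S.T x i j) S.Ω := by
  have h1 : ContDiffOn ℝ 1 (fderiv ℝ S.T) S.Ω :=
    S.contDiffOn_T.fderiv_of_isOpen S.Ω_open (by norm_num)
  have h2 : ContDiffOn ℝ 1 (fun x => fderiv ℝ S.T x (Pi.single j 1)) S.Ω :=
    h1.clm_apply contDiffOn_const
  exact (contDiffOn_pi.1 h2) i

lemma jac_eq_toMatrix' (x : Fin d → ℝ) :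
    jac S.T x = LinearMap.toMatrix' (fderiv ℝ S.T x : (Fin d → ℝ) →ₗ[ℝ] (Fin d → ℝ)) := by
  ext i j
  rw [LinearMap.toMatrix'_apply]
  rfl

lemma det_jac_ne_zero {x : Fin d → ℝ} (hx : x ∈ S.Ω) : (jac S.T x).det ≠ 0 := by
  obtain ⟨k, hk⟩ := S.exists_mem_parts hx
  obtain ⟨R, hR, hRT⟩ := S.T_inv k
  have hmaps : ∀ᶠ y in 𝓝 x, S.T y ∈ S.T '' S.parts k := by
    filter_upwards [(S.parts_open k).mem_nhds hk] with y hy using mem_image_of_mem _ hy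
  have h1 := (hR.differentiableOn one_ne_zero _ (mem_image_of_mem S.T hk)).hasFDerivWithinAt
  have h2 := (S.differentiableAt_T hx).hasFDerivAt
  have h3 := h1.comp_hasFDerivAt x h2 hmaps
  have h4 : HasFDerivAt (R ∘ S.T) (ContinuousLinearMap.id ℝ (Fin d → ℝ)) x := by
    refine (hasFDerivAt_id x).congr_of_eventuallyEq ?_
    filter_upwards [(S.parts_open k).mem_nhds hk] with y hy using hRT y hy
  have h5 := h3.unique h4
  set A := fderiv ℝ S.T x
  set B := fderivWithin ℝ R (S.T '' S.parts k) (S.T x)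
  have h6 : LinearMap.toMatrix' (B : (Fin d → ℝ) →ₗ[ℝ] (Fin d → ℝ)) * jac S.T x = 1 := by
    rw [S.jac_eq_toMatrix', ← LinearMap.toMatrix'_comp, ← ContinuousLinearMap.toLinearMap_comp, h5]
    exact LinearMap.toMatrix'_id
  have h7 := congrArg Matrix.det h6
  rw [Matrix.det_mul, Matrix.det_one] at h7
  exact right_ne_zero_of_mul_eq_one h7

lemma jac_mul_jacInv {x : Fin d → ℝ} (hx : x ∈ S.Ω) : jac S.T x * jacInv S.T x = 1 :=
  Matrix.mul_nonsing_inv _ (isUnit_iff_ne_zero.2 (S.det_jac_ne_zero hx))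

lemma contDiffOn_jacInv (i j : Fin d) : ContDiffOn ℝ 1 (fun x => jacInv S.T x i j) S.Ω :=
  contDiffOn_matrix_inv S.contDiffOn_jac (fun _ hx => S.det_jac_ne_zero hx) i j

lemma hasDerivAt_jacInv (x : Fin d → ℝ) (j a b : Fin d) {y : ℝ}
    (hy : Function.update x j y ∈ S.Ω) :
    HasDerivAt (fun t => jacInv S.T (Function.update x j t) a b)
      (fderiv ℝ (fun z => jacInv S.T z a b) (Function.update x j y) (Pi.single j 1)) y := by
  have h1 : DifferentiableAt ℝ (fun z => jacInv S.T z a b) (Function.update x j y) :=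
    ((S.contDiffOn_jacInv a b).contDiffAt (S.Ω_open.mem_nhds hy)).differentiableAt one_ne_zero
  exact h1.hasFDerivAt.comp_hasDerivAt y (hasDerivAt_update x j y)

lemma jacDj_eq {z : Fin d → ℝ} (hz : z ∈ S.Ω) (j a b : Fin d) :
    jacDj S.T j z a b = fderiv ℝ (fun w => jacInv S.T w a b) z (Pi.single j 1) := by
  have h := S.hasDerivAt_jacInv z j a b (y := z j) (by simpa using hz)
  simpa [jacDj] using h.deriv

lemma continuousOn_jacDj (j a b : Fin d) : ContinuousOn (fun z => jacDj S.T j z a b) S.Ω := by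
  have h1 : ContinuousOn (fderiv ℝ (fun w => jacInv S.T w a b)) S.Ω :=
    (S.contDiffOn_jacInv a b).continuousOn_fderiv_of_isOpen S.Ω_open le_rfl
  refine (h1.clm_apply (continuousOn_const (c := Pi.single j (1 : ℝ)))).congr fun z hz => ?_
  exact S.jacDj_eq hz j a b

lemma exists_bound_jacDj (j : Fin d) {ε : ℝ} (hε : 0 < ε) :
    ∃ C : ℝ≥0, ∀ k, ∀ z ∈ S.parts k, z ∉ bLayer (S.parts k) ε → matNorm (jacDj S.T j z) ≤ C := by
  set K : Set (Fin d → ℝ) := {z | z ∈ Icc 0 1 ∧ Metric.ball z ε ⊆ S.Ω} with hK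
  have hKΩ : K ⊆ S.Ω := fun z hz => hz.2 (Metric.mem_ball_self hε)
  have hKc : IsCompact K := by
    have : IsClosed {z : Fin d → ℝ | Metric.ball z ε ⊆ S.Ω} := by
      have : {z : Fin d → ℝ | Metric.ball z ε ⊆ S.Ω} = (Metric.thickening ε S.Ωᶜ)ᶜ := by
        ext z
        simp only [mem_ofPred_eq, mem_compl_iff, Metric.mem_thickening_iff, subset_def,
          Metric.mem_ball, not_exists, not_and, not_lt]
        refine ⟨fun h w hw => ?_, fun h w hw => ?_⟩
        · by_contra! hlt
          exact hw (h w (by rwa [dist_comm]))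
        · by_contra hw'
          have := h w hw'
          rw [dist_comm] at this
          linarith
      rw [this]
      exact Metric.isOpen_thickening.isClosed_compl
    exact isCompact_Icc.inter_right this
  have hcont : ContinuousOn (fun z => ∑ a, ∑ b, |jacDj S.T j z a b|) K :=
    continuousOn_finsetSum _ fun a _ => continuousOn_finsetSum _ fun b _ =>
      ((S.continuousOn_jacDj j a b).mono hKΩ).abs
  obtain ⟨C, hC⟩ := hKc.exists_bound_of_continuousOn hcont
  refine ⟨C.toNNReal, fun k z hz hzl => ?_⟩
  have hzi : ε ≤ Metric.infDist z (frontier (S.parts k)) := by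
    by_contra hcon
    exact hzl ⟨hz, fun h => hcon h.2⟩
  have hball : Metric.ball z ε ⊆ S.parts k := by
    by_contra hns
    obtain ⟨w, hw, hwn⟩ := not_subset.1 hns
    have hconn : IsPreconnected (Metric.ball z ε) := (convex_ball z ε).isPreconnected
    obtain ⟨u, hu, huf⟩ : (Metric.ball z ε ∩ frontier (S.parts k)).Nonempty := by
      by_contra! hemp
      have hout : ∀ u ∈ Metric.ball z ε, u ∉ S.parts k → u ∈ (closure (S.parts k))ᶜ :=
        fun u hu hun huc => by
          have : u ∈ Metric.ball z ε ∩ frontier (S.parts k) :=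
            ⟨hu, by rw [(S.parts_open k).frontier_eq]; exact ⟨huc, hun⟩⟩
          rwa [hemp] at this
      obtain ⟨u, -, hu1, hu2⟩ := hconn (S.parts k) (closure (S.parts k))ᶜ (S.parts_open k)
        isClosed_closure.isOpen_compl (fun u hu => by
          by_cases h : u ∈ S.parts k
          exacts [Or.inl h, Or.inr (hout u hu h)])
        ⟨z, Metric.mem_ball_self hε, hz⟩ ⟨w, hw, hout w hw hwn⟩
      exact hu2 (subset_closure hu1)
    have := Metric.infDist_le_dist_of_mem (x := z) huf
    rw [Metric.mem_ball, dist_comm] at hu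
    linarith
  have hzK : z ∈ K := ⟨S.Ω_subset (S.parts_subset k hz), hball.trans (S.parts_subset k)⟩
  have := hC z hzK
  rw [Real.norm_eq_abs] at this
  exact (matNorm_le_sum _).trans ((le_abs_self _).trans (this.trans (Real.le_coe_toNNReal C)))

/-- The unstable chain-rule contribution of the `j`-th coordinate to `(div φ) ∘ T`. -/
def chainTerm (φ : (Fin d → ℝ) → (Fin d → ℝ)) (j : Fin d) (z : Fin d → ℝ) : ℝ :=
  ∑ i, ∑ k, fderiv ℝ φ (S.T z) (Pi.single k 1) i * (jac S.T z k j * jacInv S.T z j i)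

lemma divg_comp_T (φ : (Fin d → ℝ) → (Fin d → ℝ)) {z : Fin d → ℝ} (hz : z ∈ S.Ω) :
    divg φ (S.T z) = ∑ j, S.chainTerm φ j z := by
  have h1 : ∀ i k, ∑ j, jac S.T z k j * jacInv S.T z j i = if k = i then 1 else 0 := fun i k => by
    rw [← Matrix.mul_apply, S.jac_mul_jacInv hz, Matrix.one_apply]
  simp only [chainTerm]
  rw [Finset.sum_comm]
  simp only [divg]
  refine Finset.sum_congr rfl fun i _ => ?_
  rw [Finset.sum_comm]
  simp only [← Finset.mul_sum, h1]
  simp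

lemma continuousOn_chainTerm {φ : (Fin d → ℝ) → (Fin d → ℝ)} (hφ : ContDiff ℝ 1 φ) (j : Fin d) :
    ContinuousOn (S.chainTerm φ j) S.Ω := by
  refine continuousOn_finsetSum _ fun i _ => continuousOn_finsetSum _ fun k _ => ?_
  refine ContinuousOn.mul ?_ ((S.contDiffOn_jac k j).continuousOn.mul
    (S.contDiffOn_jacInv j i).continuousOn)
  have h1 : Continuous fun w => fderiv ℝ φ w (Pi.single k 1) i := by
    have := hφ.continuous_fderiv one_ne_zero
    fun_prop
  exact h1.comp_continuousOn S.continuousOn_T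

lemma integrableOn_chainTerm {φ : (Fin d → ℝ) → (Fin d → ℝ)} (hφ : ContDiff ℝ 1 φ)
    (hφc : HasCompactSupport φ) (j : Fin d) : IntegrableOn (S.chainTerm φ j) S.Ω := by
  refine integrable_finsetSum _ fun i _ => integrable_finsetSum _ fun k _ => ?_
  have h1 : Continuous fun w => fderiv ℝ φ w (Pi.single k 1) i := by
    have := hφ.continuous_fderiv one_ne_zero
    fun_prop
  obtain ⟨C, hC⟩ := (hφc.fderiv (𝕜 := ℝ)).exists_bound_of_continuous
    (hφ.continuous_fderiv one_ne_zero)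
  refine (S.h5 i j k).bdd_mul (c := C) ?_ ?_
  · exact (h1.comp_continuousOn S.continuousOn_T).aestronglyMeasurable
      S.Ω_open.measurableSet
  · refine ae_of_all _ fun z => ?_
    refine (norm_le_pi_norm (fderiv ℝ φ (S.T z) (Pi.single k 1)) i).trans ?_
    refine (ContinuousLinearMap.le_opNorm _ _).trans ?_
    rw [Pi.norm_single, norm_one, mul_one]
    exact hC _

lemma hasDerivAt_jacInv_mul {φ : (Fin d → ℝ) → (Fin d → ℝ)} (hφ : ContDiff ℝ 1 φ) (j : Fin d)
    (x : Fin d → ℝ) {y : ℝ} (hy : Function.update x j y ∈ S.Ω) :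
    HasDerivAt (fun t => ∑ i, jacInv S.T (Function.update x j t) j i *
        φ (S.T (Function.update x j t)) i)
      (S.chainTerm φ j (Function.update x j y) + ∑ i, jacDj S.T j (Function.update x j y) j i *
        φ (S.T (Function.update x j y)) i) y := by
  set z := Function.update x j y with hz
  have hT : HasDerivAt (fun t => S.T (Function.update x j t))
      (fderiv ℝ S.T z (Pi.single j 1)) y :=
    (S.differentiableAt_T hy).hasFDerivAt.comp_hasDerivAt y (hasDerivAt_update x j y)
  have hφT : HasDerivAt (fun t => φ (S.T (Function.update x j t)))
      (fderiv ℝ φ (S.T z) (fderiv ℝ S.T z (Pi.single j 1))) y :=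
    ((hφ.differentiable one_ne_zero) _).hasFDerivAt.comp_hasDerivAt y hT
  have hdec : fderiv ℝ S.T z (Pi.single j 1) = ∑ k, jac S.T z k j • Pi.single k (1 : ℝ) := by
    conv_lhs => rw [← Finset.univ_sum_single (fderiv ℝ S.T z (Pi.single j 1))]
    refine Finset.sum_congr rfl fun k _ => ?_
    rw [← Pi.single_smul, smul_eq_mul, mul_one]; rfl
  have hterm : ∀ i, HasDerivAt (fun t => jacInv S.T (Function.update x j t) j i *
        φ (S.T (Function.update x j t)) i)
      (jacDj S.T j z j i * φ (S.T z) i + jacInv S.T z j i *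
        ∑ k, fderiv ℝ φ (S.T z) (Pi.single k 1) i * jac S.T z k j) y := by
    intro i
    have h1 := S.hasDerivAt_jacInv x j j i hy
    rw [← hz, ← S.jacDj_eq hy] at h1
    have h2 := (hasDerivAt_pi.1 hφT) i
    rw [hdec, map_sum, Finset.sum_apply] at h2
    refine (h1.mul h2).congr_deriv ?_
    simp only [map_smul, Pi.smul_apply, smul_eq_mul, mul_comm]
    rfl
  refine (HasDerivAt.fun_sum fun i _ => hterm i).congr_deriv ?_
  rw [Finset.sum_add_distrib, add_comm]
  congr 1
  refine Finset.sum_congr rfl fun i _ => ?_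
  rw [Finset.mul_sum]
  refine Finset.sum_congr rfl fun k _ => ?_
  ring

end PES

lemma enorm_le_lintegral_deriv {v : ℝ → ℝ} (hv : ContDiff ℝ 1 v) (hvc : HasCompactSupport v)
    (y : ℝ) : ‖v y‖ₑ ≤ ∫⁻ t, ‖deriv v t‖ₑ := by
  rw [← hvc.integral_Iic_deriv_eq hv y]
  exact (enorm_integral_le_lintegral_enorm _).trans (setLIntegral_le_lintegral _ _)

lemma contDiff_comp_update {d : ℕ} {v : (Fin d → ℝ) → ℝ} (hv : ContDiff ℝ 1 v) (x : Fin d → ℝ)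
    (j : Fin d) : ContDiff ℝ 1 fun y => v (Function.update x j y) :=
  hv.comp (contDiff_update 1 x j)

lemma deriv_comp_update {d : ℕ} {v : (Fin d → ℝ) → ℝ} (hv : ContDiff ℝ 1 v) (x : Fin d → ℝ)
    (j : Fin d) (y : ℝ) : deriv (fun y => v (Function.update x j y)) y =
      fderiv ℝ v (Function.update x j y) (Pi.single j 1) :=
  (((hv.differentiable one_ne_zero) _).hasFDerivAt.comp_hasDerivAt y
    (hasDerivAt_update x j y)).deriv

lemma hasCompactSupport_comp_update {d : ℕ} {v : (Fin d → ℝ) → ℝ} (hv : HasCompactSupport v)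
    (x : Fin d → ℝ) (j : Fin d) : HasCompactSupport fun y => v (Function.update x j y) := by
  refine HasCompactSupport.intro (hv.image (continuous_apply j)) fun y hy => ?_
  by_contra h
  exact hy ⟨Function.update x j y, subset_tsupport v h, by simp⟩

namespace PES

variable {d : ℕ} (S : PES d)

lemma enorm_slice_integral_le {φ : (Fin d → ℝ) → (Fin d → ℝ)} (hφ : IsTest d φ) (j : Fin d)
    {ε : ℝ} {η : ℝ≥0∞} {C : ℝ≥0}
    (hlayer : ∀ x : Fin d → ℝ, (∑' k : ℕ, ∫⁻ y in Set.Icc (0:ℝ) 1,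
        Set.indicator (bLayer (S.parts k) ε)
          (fun z => ENNReal.ofReal (matNorm (jacDj S.T j z)))
          (Function.update x j y)) ≤ η)
    (hC : ∀ k, ∀ z ∈ S.parts k, z ∉ bLayer (S.parts k) ε → matNorm (jacDj S.T j z) ≤ C)
    (x : Fin d → ℝ) {v : ℝ → ℝ} (hv : ContDiff ℝ 1 v) (hvc : HasCompactSupport v) :
    ‖∫ y in {y | Function.update x j y ∈ S.Ω},
        v y * S.chainTerm φ j (Function.update x j y)‖ₑ ≤
      ENNReal.ofReal S.lam⁻¹ * (∫⁻ y, (‖deriv v y‖ₑ + ENNReal.ofReal S.δ⁻¹ * ‖v y‖ₑ)) +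
        (C * (∫⁻ y, ‖v y‖ₑ) + (∫⁻ y, ‖deriv v y‖ₑ) * η) := by
  have hcu : Continuous (Function.update x j) := continuous_const.update j continuous_id
  have hpart : ∀ k, {y : ℝ | Function.update x j y ∈ S.parts k} = ⋃ ℓ, S.Ifam j x k ℓ :=
    S.Ifam_union j x
  have hU : {y | Function.update x j y ∈ S.Ω} = ⋃ p : ℕ × ℕ, S.Ifam j x p.1 p.2 := by
    rw [iUnion_prod']
    simp only [← hpart]
    ext y
    simp [← S.parts_union]
  have h01 : ∀ y, Function.update x j y ∈ S.Ω → y ∈ Icc (0 : ℝ) 1 := fun y hy => by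
    have := S.Ω_subset hy
    have h0 := this.1 j
    have h1 := this.2 j
    simp only [Function.update_self] at h0 h1
    exact ⟨h0, h1⟩
  rcases Set.eq_empty_or_nonempty {y | Function.update x j y ∈ S.Ω} with hemp | ⟨y₀, hy₀⟩
  · rw [hemp]; simp
  have hx : ∀ y ∈ Icc (0 : ℝ) 1, Function.update x j y ∈ Icc (0 : Fin d → ℝ) 1 := by
    intro y hy
    have := S.Ω_subset hy₀
    refine ⟨fun i => ?_, fun i => ?_⟩
    · have h0 := this.1 i
      by_cases hij : i = j
      · subst hij; simpa using hy.1
      · simpa [Function.update_of_ne hij] using h0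
    · have h0 := this.2 i
      by_cases hij : i = j
      · subst hij; simpa using hy.2
      · simpa [Function.update_of_ne hij] using h0
  have hmapsU : ∀ y ∈ ⋃ p : ℕ × ℕ, S.Ifam j x p.1 p.2, Function.update x j y ∈ S.Ω := by
    intro y hy; rw [← hU] at hy; exact hy
  have hφT : ∀ i, ContinuousOn (fun z => φ (S.T z) i) S.Ω := fun i =>
    ((continuous_apply i).comp hφ.1.continuous).comp_continuousOn S.continuousOn_T
  set F : (Fin d → ℝ) → ℝ := fun z => ∑ i, jacDj S.T j z j i * φ (S.T z) i with hFdef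
  have hF : ContinuousOn F S.Ω := continuousOn_finsetSum _ fun i _ =>
    (S.continuousOn_jacDj j j i).mul (hφT i)
  have hFle : ∀ z, ‖F z‖ₑ ≤ ENNReal.ofReal (matNorm (jacDj S.T j z)) := fun z => by
    rw [Real.enorm_eq_ofReal_abs]
    exact ENNReal.ofReal_le_ofReal (abs_sum_mul_le_matNorm _ _ (hφ.2.2 _))
  rw [hU]
  refine enorm_integral_iUnion_le (fun p => S.Ifam_open j x p.1 p.2)
    (fun p => S.Ifam_conn j x p.1 p.2) (fun p y hy => h01 y (hmapsU y (mem_iUnion.2 ⟨p, hy⟩)))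
    ?_ S.δ_pos
    (m := fun y => ENNReal.ofReal (matNorm (jacInv S.T (Function.update x j y))))
    (F := fun y => F (Function.update x j y))
    (ψ := fun t => ∑ i, jacInv S.T (Function.update x j t) j i *
        φ (S.T (Function.update x j t)) i)
    ENNReal.ofReal_ne_top ?_ hv ?_ ?_ ?_ ?_ ?_
  · rintro ⟨k, ℓ⟩ ⟨k', ℓ'⟩ hne
    by_cases hk : k = k'
    · subst hk
      exact S.Ifam_disj j x k fun h => hne (by simp only at h; rw [h])
    · refine Set.disjoint_left.2 fun y hy hy' => ?_
      have h1 : y ∈ {y : ℝ | Function.update x j y ∈ S.parts k} := by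
        rw [hpart]; exact mem_iUnion.2 ⟨ℓ, hy⟩
      have h2 : y ∈ {y : ℝ | Function.update x j y ∈ S.parts k'} := by
        rw [hpart]; exact mem_iUnion.2 ⟨ℓ', hy'⟩
      exact Set.disjoint_left.1 (S.parts_disj hk) h1 h2
  · intro y hy
    have h := S.h3 _ (hx y hy) j
    have hI : ∀ p : ℕ × ℕ, S.Ifam j (Function.update x j y) p.1 p.2 = S.Ifam j x p.1 p.2 :=
      fun p => S.Ifam_indep j _ _ _ _ fun i hi => Function.update_of_ne hi _ _
    simp only [hI, Function.update_self, Function.update_idem] at h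
    exact h
  · intro y hy
    exact S.hasDerivAt_jacInv_mul hφ.1 j x (hmapsU y hy)
  · exact (S.continuousOn_chainTerm hφ.1 j).comp hcu.continuousOn hmapsU
  · exact hF.comp hcu.continuousOn hmapsU
  · intro y _
    rw [Real.enorm_eq_ofReal_abs]
    exact ENNReal.ofReal_le_ofReal (abs_sum_mul_le_matNorm _ _ (hφ.2.2 _))
  · have hU' : ⋃ p : ℕ × ℕ, S.Ifam j x p.1 p.2
        = ⋃ k, {y : ℝ | Function.update x j y ∈ S.parts k} := by
      rw [iUnion_prod']
      simp only [← hpart]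
    have hmk : ∀ k, MeasurableSet {y : ℝ | Function.update x j y ∈ S.parts k} := fun k =>
      ((S.parts_open k).preimage hcu).measurableSet
    have hdk : Pairwise (Function.onFun Disjoint
        fun k => {y : ℝ | Function.update x j y ∈ S.parts k}) := by
      intro k k' hkk
      exact Set.disjoint_left.2 fun y h1 h2 => Set.disjoint_left.1 (S.parts_disj hkk) h1 h2
    have hvm : Measurable fun y => (C : ℝ≥0∞) * ‖v y‖ₑ := by
      have := hv.continuous
      fun_prop
    rw [hU', lintegral_iUnion hmk hdk]
    calc ∑' k, ∫⁻ y in {y : ℝ | Function.update x j y ∈ S.parts k},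
            ‖v y * F (Function.update x j y)‖ₑ
        ≤ ∑' k, ((∫⁻ y in {y : ℝ | Function.update x j y ∈ S.parts k}, C * ‖v y‖ₑ) +
            (∫⁻ t, ‖deriv v t‖ₑ) * ∫⁻ y in Set.Icc (0:ℝ) 1,
              Set.indicator (bLayer (S.parts k) ε)
                (fun z => ENNReal.ofReal (matNorm (jacDj S.T j z))) (Function.update x j y)) := by
          refine ENNReal.tsum_le_tsum fun k => ?_
          have hsub : {y : ℝ | Function.update x j y ∈ S.parts k} ⊆ Icc 0 1 := fun y hy =>
            h01 y (S.parts_subset k hy)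
          have hfin : (∫⁻ t, ‖deriv v t‖ₑ) ≠ ⊤ := by
            have hi : Integrable (deriv v) :=
              (hv.continuous_deriv le_rfl).integrable_of_hasCompactSupport hvc.deriv
            exact hi.2.ne
          refine le_trans ?_ (add_le_add_right (mul_le_mul_right (lintegral_mono_set hsub) _) _)
          rw [← lintegral_const_mul' _ _ hfin, ← lintegral_add_left hvm]
          refine setLIntegral_mono' (hmk k) fun y hy => ?_
          rw [enorm_mul]
          by_cases hl : Function.update x j y ∈ bLayer (S.parts k) ε
          · rw [indicator_of_mem hl]
            exact le_add_left (mul_le_mul' (enorm_le_lintegral_deriv hv hvc y) (hFle _))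
          · rw [indicator_of_notMem hl, mul_zero, add_zero, mul_comm]
            gcongr
            refine (hFle _).trans ?_
            have := ENNReal.ofReal_le_ofReal (hC k _ hy hl)
            rwa [ENNReal.ofReal_coe_nnreal] at this
      _ = (∫⁻ y in ⋃ k, {y : ℝ | Function.update x j y ∈ S.parts k}, C * ‖v y‖ₑ) +
            (∫⁻ t, ‖deriv v t‖ₑ) * ∑' k, ∫⁻ y in Set.Icc (0:ℝ) 1,
              Set.indicator (bLayer (S.parts k) ε)
                (fun z => ENNReal.ofReal (matNorm (jacDj S.T j z))) (Function.update x j y) := by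
          rw [ENNReal.tsum_add, ENNReal.tsum_mul_left, lintegral_iUnion hmk hdk]
      _ ≤ _ := by
          gcongr
          · refine (setLIntegral_le_lintegral _ _).trans ?_
            rw [lintegral_const_mul' _ _ ENNReal.coe_ne_top]
          · exact hlayer x

end PES

lemma measurePreserving_insertNth {n : ℕ} (j : Fin (n + 1)) :
    MeasurePreserving (fun p : ℝ × (Fin n → ℝ) => (j.insertNth p.1 p.2 : Fin (n + 1) → ℝ))
      (volume.prod volume) volume :=
  (volume_preserving_piFinSuccAbove (fun _ => ℝ) j).symm

lemma lintegral_eq_lintegral_slices {n : ℕ} (j : Fin (n + 1)) {f : (Fin (n + 1) → ℝ) → ℝ≥0∞}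
    (hf : Measurable f) : ∫⁻ z, f z = ∫⁻ x' : Fin n → ℝ, ∫⁻ y : ℝ,
      f (Function.update (j.insertNth 0 x') j y) := by
  have hmp := measurePreserving_insertNth j
  rw [← hmp.lintegral_comp hf]
  refine (lintegral_prod_symm _ (hf.comp hmp.measurable).aemeasurable).trans ?_
  simp only [Function.comp_apply, Fin.update_insertNth]

lemma integral_eq_integral_slices {n : ℕ} (j : Fin (n + 1)) {f : (Fin (n + 1) → ℝ) → ℝ}
    (hf : Integrable f) : ∫ z, f z = ∫ x' : Fin n → ℝ, ∫ y : ℝ,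
      f (Function.update (j.insertNth 0 x') j y) := by
  have hmp := measurePreserving_insertNth j
  have hemb : MeasurableEmbedding
      (fun p : ℝ × (Fin n → ℝ) => (j.insertNth p.1 p.2 : Fin (n + 1) → ℝ)) :=
    (MeasurableEquiv.piFinSuccAbove (fun _ => ℝ) j).symm.measurableEmbedding
  rw [← hmp.integral_comp hemb]
  refine (integral_prod_symm _ (hmp.integrable_comp_of_integrable hf)).trans ?_
  simp only [Function.comp_apply, Fin.update_insertNth]

namespace PES

lemma enorm_integral_chainTerm_le {d : ℕ} (S : PES d) {φ : (Fin d → ℝ) → (Fin d → ℝ)}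
    (hφ : IsTest d φ) (j : Fin d)
    {ε : ℝ} {η C : ℝ≥0}
    (hlayer : ∀ x : Fin d → ℝ, (∑' k : ℕ, ∫⁻ y in Set.Icc (0:ℝ) 1,
        Set.indicator (bLayer (S.parts k) ε)
          (fun z => ENNReal.ofReal (matNorm (jacDj S.T j z)))
          (Function.update x j y)) ≤ η)
    (hC : ∀ k, ∀ z ∈ S.parts k, z ∉ bLayer (S.parts k) ε → matNorm (jacDj S.T j z) ≤ C)
    {v : (Fin d → ℝ) → ℝ} (hv : ContDiff ℝ 1 v) (hvc : HasCompactSupport v) :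
    ‖∫ z in S.Ω, v z * S.chainTerm φ j z‖ₑ ≤
      (ENNReal.ofReal S.lam⁻¹ + η) * (∫⁻ z, ‖fderiv ℝ v z (Pi.single j 1)‖ₑ) +
        (ENNReal.ofReal S.lam⁻¹ * ENNReal.ofReal S.δ⁻¹ + C) * ∫⁻ z, ‖v z‖ₑ := by
  cases d with
  | zero => exact j.elim0
  | succ n =>
  have hvcont := hv.continuous
  have hdcont : Continuous fun z => fderiv ℝ v z (Pi.single j 1) := by
    have := hv.continuous_fderiv one_ne_zero
    fun_prop
  have hintegrable : IntegrableOn (fun z => v z * S.chainTerm φ j z) S.Ω := by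
    obtain ⟨M, hM⟩ := hvc.exists_bound_of_continuous hvcont
    exact (S.integrableOn_chainTerm hφ.1 hφ.2.1 j).bdd_mul hvcont.aestronglyMeasurable
      (ae_of_all _ hM)
  have hΩm := S.Ω_open.measurableSet
  set G : (Fin (n + 1) → ℝ) → ℝ≥0∞ := fun z =>
    (ENNReal.ofReal S.lam⁻¹ + η) * ‖fderiv ℝ v z (Pi.single j 1)‖ₑ +
        (ENNReal.ofReal S.lam⁻¹ * ENNReal.ofReal S.δ⁻¹ + C) * ‖v z‖ₑ with hG
  have hGm : Measurable G := by fun_prop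
  have hGi : ∫⁻ z, G z = (ENNReal.ofReal S.lam⁻¹ + η) *
        (∫⁻ z, ‖fderiv ℝ v z (Pi.single j 1)‖ₑ) +
        (ENNReal.ofReal S.lam⁻¹ * ENNReal.ofReal S.δ⁻¹ + C) * ∫⁻ z, ‖v z‖ₑ := by
    rw [hG, lintegral_add_left (by fun_prop), lintegral_const_mul _ (by fun_prop),
      lintegral_const_mul _ (by fun_prop)]
  rw [← hGi, lintegral_eq_lintegral_slices j hGm, ← integral_indicator hΩm,
    integral_eq_integral_slices j ((integrable_indicator_iff hΩm).2 hintegrable)]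
  refine (enorm_integral_le_lintegral_enorm _).trans (lintegral_mono fun x' => ?_)
  set x : Fin (n + 1) → ℝ := j.insertNth 0 x'
  have hcu : Continuous (Function.update x j) := continuous_const.update j continuous_id
  have hsl := S.enorm_slice_integral_le hφ j hlayer hC x (contDiff_comp_update hv x j)
    (hasCompactSupport_comp_update hvc x j)
  have hms : MeasurableSet {y | Function.update x j y ∈ S.Ω} :=
    (S.Ω_open.preimage hcu).measurableSet
  rw [← integral_indicator hms] at hsl
  refine hsl.trans (le_of_eq ?_)
  simp only [deriv_comp_update hv, hG]
  have m1 : Measurable fun y => ‖fderiv ℝ v (Function.update x j y) (Pi.single j 1)‖ₑ :=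
    (hdcont.comp hcu).measurable.enorm
  have m2 : Measurable fun y => ‖v (Function.update x j y)‖ₑ :=
    (hvcont.comp hcu).measurable.enorm
  rw [lintegral_add_left m1, lintegral_const_mul _ m2, lintegral_add_left (m1.const_mul _),
    lintegral_const_mul _ m1, lintegral_const_mul _ m2]
  ring

/-- Dual form of the Lasota–Yorke inequality. -/
theorem exists_lasotaYorke {d : ℕ} (S : PES d) :
    ∃ σ B : ℝ≥0, σ < 1 ∧ ∀ φ : (Fin d → ℝ) → (Fin d → ℝ), IsTest d φ →
      ∀ v : (Fin d → ℝ) → ℝ, ContDiff ℝ 1 v → HasCompactSupport v →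
        ‖∫ z in S.Ω, v z * divg φ (S.T z)‖ₑ ≤
          σ * (∑ j, ∫⁻ z, ‖fderiv ℝ v z (Pi.single j 1)‖ₑ) + B * ∫⁻ z, ‖v z‖ₑ := by
  have hl1 : S.lam⁻¹ < 1 := inv_lt_one_of_one_lt₀ S.lam_gt_one
  have hl0 : 0 < S.lam⁻¹ := inv_pos.2 (zero_lt_one.trans S.lam_gt_one)
  set η : ℝ≥0 := ((1 - S.lam⁻¹) / 2).toNNReal with hη
  have hη0 : (0 : ℝ≥0∞) < η := by
    rw [ENNReal.coe_pos, hη, Real.toNNReal_pos]; linarith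
  have hexε : ∀ j : Fin d, ∃ ε : ℝ, 0 < ε ∧ ∀ x : Fin d → ℝ, (∑' k : ℕ, ∫⁻ y in Set.Icc (0:ℝ) 1,
        Set.indicator (bLayer (S.parts k) ε)
          (fun z => ENNReal.ofReal (matNorm (jacDj S.T j z)))
          (Function.update x j y)) ≤ η := by
    intro j
    have h1 := (S.h4 j).eventually_le_const hη0
    obtain ⟨ε, hε, hε0⟩ := (h1.and self_mem_nhdsWithin).exists
    exact ⟨ε, hε0, fun x => (le_iSup (fun x : Fin d → ℝ => ∑' k : ℕ, ∫⁻ y in Set.Icc (0:ℝ) 1,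
        Set.indicator (bLayer (S.parts k) ε)
          (fun z => ENNReal.ofReal (matNorm (jacDj S.T j z)))
          (Function.update x j y)) x).trans hε⟩
  choose ε hε0 hε using hexε
  choose C hC using fun j => S.exists_bound_jacDj j (hε0 j)
  refine ⟨S.lam⁻¹.toNNReal + η,
    ∑ j, (S.lam⁻¹.toNNReal * S.δ⁻¹.toNNReal + C j), ?_, fun φ hφ v hv hvc => ?_⟩
  · rw [hη, ← Real.toNNReal_add hl0.le (by linarith), Real.toNNReal_lt_one]
    linarith
  have hsum : ∫ z in S.Ω, v z * divg φ (S.T z) = ∑ j, ∫ z in S.Ω, v z * S.chainTerm φ j z := by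
    obtain ⟨M, hM⟩ := hvc.exists_bound_of_continuous hv.continuous
    rw [← integral_finsetSum _ fun j _ => (S.integrableOn_chainTerm hφ.1 hφ.2.1 j).bdd_mul
      hv.continuous.aestronglyMeasurable (ae_of_all _ hM)]
    refine setIntegral_congr_fun S.Ω_open.measurableSet fun z hz => ?_
    simp only [S.divg_comp_T φ hz, Finset.mul_sum]
  rw [hsum]
  refine (enorm_sum_le _ _).trans ?_
  refine (Finset.sum_le_sum fun j _ =>
    S.enorm_integral_chainTerm_le hφ j (hε j) (hC j) hv hvc).trans (le_of_eq ?_)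
  rw [Finset.sum_add_distrib, ← Finset.mul_sum, ← Finset.sum_mul]
  push_cast
  rfl

end PES

section Smoothing

variable {E Z : Type*} [NormedAddCommGroup E] [MeasurableSpace Z]

/-- The smooth density `x ↦ ∫ f(z) Θ(x - τ(z)) dμ(z)` obtained by pushing forward `f μ` under `τ`
and mollifying with the kernel `Θ`. -/
def smoothPush (μ : Measure Z) (τ : Z → E) (Θ : E → ℝ) (f : Z → ℝ) (x : E) : ℝ :=
  ∫ z, f z * Θ (x - τ z) ∂μ

variable {μ : Measure Z} {τ : Z → E} {Θ : E → ℝ} {f : Z → ℝ}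

lemma integrable_mul_comp_sub (hf : Integrable f μ) (hτ : AEStronglyMeasurable τ μ)
    (hΘ : Continuous Θ) (hΘc : HasCompactSupport Θ) (x : E) :
    Integrable (fun z => f z * Θ (x - τ z)) μ := by
  obtain ⟨M, hM⟩ := hΘc.exists_bound_of_continuous hΘ
  exact hf.mul_bdd (c := M) (hΘ.comp_aestronglyMeasurable (aestronglyMeasurable_const.sub hτ))
    (ae_of_all _ fun z => hM _)

lemma hasCompactSupport_smoothPush {K : Set E} (hK : IsCompact K)
    (hτK : ∀ᵐ z ∂μ, f z ≠ 0 → τ z ∈ K) (hΘc : HasCompactSupport Θ) :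
    HasCompactSupport (smoothPush μ τ Θ f) := by
  refine HasCompactSupport.intro (hΘc.isCompact.add hK) fun x hx => ?_
  refine integral_eq_zero_of_ae ?_
  filter_upwards [hτK] with z hz
  by_contra hne
  have hne : f z * Θ (x - τ z) ≠ 0 := hne
  exact hx ⟨x - τ z, subset_tsupport _ (right_ne_zero_of_mul hne), τ z,
    hz (left_ne_zero_of_mul hne), sub_add_cancel _ _⟩

lemma smoothPush_sub {g : Z → ℝ} (hf : Integrable f μ) (hg : Integrable g μ)
    (hτ : AEStronglyMeasurable τ μ) (hΘ : Continuous Θ) (hΘc : HasCompactSupport Θ) (x : E) :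
    smoothPush μ τ Θ f x - smoothPush μ τ Θ g x = smoothPush μ τ Θ (fun z => f z - g z) x := by
  simp only [smoothPush, sub_mul]
  exact (integral_sub (integrable_mul_comp_sub hf hτ hΘ hΘc x)
    (integrable_mul_comp_sub hg hτ hΘ hΘc x)).symm

variable [NormedSpace ℝ E]

lemma integrable_smul_fderiv_comp_sub (hf : Integrable f μ) (hτ : AEStronglyMeasurable τ μ)
    (hΘ : ContDiff ℝ 1 Θ) (hΘc : HasCompactSupport Θ) (x : E) :
    Integrable (fun z => f z • fderiv ℝ Θ (x - τ z)) μ := by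
  have hc := hΘ.continuous_fderiv one_ne_zero
  obtain ⟨M, hM⟩ := (hΘc.fderiv ℝ).exists_bound_of_continuous hc
  exact hf.smul_bdd M (hc.comp_aestronglyMeasurable (aestronglyMeasurable_const.sub hτ))
    (ae_of_all _ fun z => hM _)

lemma hasFDerivAt_smoothPush (hf : Integrable f μ) (hτ : AEStronglyMeasurable τ μ)
    (hΘ : ContDiff ℝ 1 Θ) (hΘc : HasCompactSupport Θ) (x : E) :
    HasFDerivAt (smoothPush μ τ Θ f) (∫ z, f z • fderiv ℝ Θ (x - τ z) ∂μ) x := by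
  have hc := hΘ.continuous_fderiv one_ne_zero
  obtain ⟨M, hM⟩ := (hΘc.fderiv ℝ).exists_bound_of_continuous hc
  refine hasFDerivAt_integral_of_dominated_of_fderiv_le (bound := fun z => ‖f z‖ * M)
    (F' := fun x z => f z • fderiv ℝ Θ (x - τ z)) univ_mem
    (.of_forall fun x => (integrable_mul_comp_sub hf hτ hΘ.continuous hΘc x).1)
    (integrable_mul_comp_sub hf hτ hΘ.continuous hΘc x)
    (integrable_smul_fderiv_comp_sub hf hτ hΘ hΘc x).1
    (ae_of_all _ fun z y _ => ?_) (hf.norm.mul_const M) (ae_of_all _ fun z y _ => ?_)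
  · rw [norm_smul]
    gcongr
    exact hM _
  · have h1 : HasFDerivAt Θ (fderiv ℝ Θ (y - τ z)) (y - τ z) :=
      (hΘ.differentiable one_ne_zero _).hasFDerivAt
    have h2 := h1.comp y ((hasFDerivAt_id y).sub_const (τ z))
    exact h2.const_mul (f z)

lemma contDiff_smoothPush (hf : Integrable f μ) (hτ : AEStronglyMeasurable τ μ)
    (hΘ : ContDiff ℝ 1 Θ) (hΘc : HasCompactSupport Θ) : ContDiff ℝ 1 (smoothPush μ τ Θ f) := by
  have hc := hΘ.continuous_fderiv one_ne_zero
  obtain ⟨M, hM⟩ := (hΘc.fderiv ℝ).exists_bound_of_continuous hc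
  refine contDiff_one_iff_hasFDerivAt.2 ⟨_, ?_, hasFDerivAt_smoothPush hf hτ hΘ hΘc⟩
  refine continuous_of_dominated (bound := fun z => ‖f z‖ * M)
    (fun x => (integrable_smul_fderiv_comp_sub hf hτ hΘ hΘc x).1)
    (fun x => ae_of_all _ fun z => ?_) (hf.norm.mul_const M) (ae_of_all _ fun z => ?_)
  · rw [norm_smul]
    gcongr
    exact hM _
  · exact (hc.comp (continuous_id.sub continuous_const)).const_smul (f z)

lemma fderiv_smoothPush_apply (hf : Integrable f μ) (hτ : AEStronglyMeasurable τ μ)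
    (hΘ : ContDiff ℝ 1 Θ) (hΘc : HasCompactSupport Θ) (x e : E) :
    fderiv ℝ (smoothPush μ τ Θ f) x e = ∫ z, f z * fderiv ℝ Θ (x - τ z) e ∂μ := by
  rw [(hasFDerivAt_smoothPush hf hτ hΘ hΘc x).fderiv,
    ContinuousLinearMap.integral_apply (integrable_smul_fderiv_comp_sub hf hτ hΘ hΘc x)]
  rfl

variable [MeasurableSpace E] [FiniteDimensional ℝ E]

lemma fderiv_normed_neg (ρ : ContDiffBump (0 : E)) (ν : Measure E) (x : E) :
    fderiv ℝ (ρ.normed ν) (-x) = -fderiv ℝ (ρ.normed ν) x := by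
  have hd : DifferentiableAt ℝ (ρ.normed ν) (-x) :=
    (ρ.contDiff_normed (n := 1)).differentiable one_ne_zero _
  have h := hd.hasFDerivAt.comp x (hasFDerivAt_id x).fun_neg
  have he : ρ.normed ν ∘ Neg.neg = ρ.normed ν := funext fun y => ρ.normed_neg y
  rw [he] at h
  rw [h.fderiv]
  ext e
  simp

variable [BorelSpace E]

lemma lintegral_enorm_smoothPush_le {ν : Measure E} [ν.IsAddHaarMeasure] [SFinite μ]
    (hf : Integrable f μ) (hτ : AEStronglyMeasurable τ μ) (hΘ : Continuous Θ)
    (hΘ1 : ∫⁻ x, ‖Θ x‖ₑ ∂ν = 1) :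
    ∫⁻ x, ‖smoothPush μ τ Θ f x‖ₑ ∂ν ≤ ∫⁻ z, ‖f z‖ₑ ∂μ := by
  have hm : AEMeasurable (fun p : E × Z => ‖f p.2 * Θ (p.1 - τ p.2)‖ₑ) (ν.prod μ) :=
    (hf.1.comp_snd.mul (hΘ.comp_aestronglyMeasurable
      (measurable_fst.aestronglyMeasurable.sub hτ.comp_snd))).enorm
  calc ∫⁻ x, ‖smoothPush μ τ Θ f x‖ₑ ∂ν
      ≤ ∫⁻ x, ∫⁻ z, ‖f z * Θ (x - τ z)‖ₑ ∂μ ∂ν :=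
        lintegral_mono fun x => enorm_integral_le_lintegral_enorm _
    _ = ∫⁻ z, ∫⁻ x, ‖f z * Θ (x - τ z)‖ₑ ∂ν ∂μ := lintegral_lintegral_swap hm
    _ = ∫⁻ z, ‖f z‖ₑ ∂μ := by
        refine lintegral_congr fun z => ?_
        simp only [enorm_mul]
        have hms : Measurable fun x => ‖Θ (x - τ z)‖ₑ :=
          (hΘ.measurable.comp (measurable_id.sub_const (τ z))).enorm
        rw [lintegral_const_mul _ hms, lintegral_sub_right_eq_self (fun x => ‖Θ x‖ₑ), hΘ1, mul_one]

lemma lintegral_enorm_normed (ρ : ContDiffBump (0 : E)) (ν : Measure E) [ν.IsAddHaarMeasure] :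
    ∫⁻ x, ‖ρ.normed ν x‖ₑ ∂ν = 1 := by
  have h := ofReal_integral_eq_lintegral_ofReal (ρ.integrable_normed (μ := ν))
    (ae_of_all _ ρ.nonneg_normed)
  rw [ρ.integral_normed, ENNReal.ofReal_one] at h
  rw [h]
  exact lintegral_congr fun x => Real.enorm_of_nonneg (ρ.nonneg_normed x)

lemma exists_lintegral_sub_smoothPush_le {ν : Measure E} [ν.IsAddHaarMeasure]
    {g : E → ℝ} (hg : Integrable g ν) {ε : ℝ≥0∞} (hε : ε ≠ 0) :
    ∃ ρ : ContDiffBump (0 : E), ∫⁻ x, ‖g x - smoothPush ν id (ρ.normed ν) g x‖ₑ ∂ν ≤ ε := by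
  have hε3 : ε / 3 ≠ 0 := ENNReal.div_ne_zero.2 ⟨hε, by norm_num⟩
  obtain ⟨u, huc, hgu, hu, hui⟩ := hg.exists_hasCompactSupport_lintegral_sub_le hε3
  set K := Metric.cthickening 1 (tsupport u)
  have hK : IsCompact K := huc.isCompact.cthickening
  obtain ⟨η, hη0, hη⟩ := ENNReal.exists_nnreal_pos_mul_lt (hK.measure_lt_top (μ := ν)).ne hε3
  obtain ⟨δ, hδ0, hδ⟩ := Metric.uniformContinuous_iff.1
    (huc.uniformContinuous_of_continuous hu) η hη0
  have hr : 0 < min δ 1 := lt_min hδ0 one_pos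
  set ρ : ContDiffBump (0 : E) := ⟨min δ 1 / 2, min δ 1, half_pos hr, half_lt_self hr⟩
  have hρ : ContDiff ℝ 1 (ρ.normed ν) := ρ.contDiff_normed
  have hρc : HasCompactSupport (ρ.normed ν) := ρ.hasCompactSupport_normed
  have hid : AEStronglyMeasurable (id : E → E) ν := aestronglyMeasurable_id
  refine ⟨ρ, ?_⟩
  have hconv : ∀ x, smoothPush ν id (ρ.normed ν) u x =
      convolution (ρ.normed ν) u (ContinuousLinearMap.lsmul ℝ ℝ) ν x := by
    intro x
    rw [convolution_eq_swap]
    exact integral_congr_ae (ae_of_all _ fun z => mul_comm _ _)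
  have hpt : ∀ x, ‖u x - smoothPush ν id (ρ.normed ν) u x‖ₑ ≤
      K.indicator (fun _ => (η : ℝ≥0∞)) x := by
    intro x
    rw [enorm_sub_rev, ← edist_eq_enorm_sub, hconv]
    by_cases hx : x ∈ K
    · rw [indicator_of_mem hx, edist_le_coe, ← NNReal.coe_le_coe, coe_nndist]
      exact ρ.dist_normed_convolution_le hui.1 fun y hy =>
        (hδ ((Metric.mem_ball.1 hy).trans_le (min_le_left _ _))).le
    · rw [indicator_of_notMem hx, nonpos_iff_eq_zero, edist_eq_zero, ← dist_le_zero]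
      have h0 : ∀ y, dist y x ≤ 1 → u y = 0 := fun y hy => by
        by_contra hne
        exact hx (Metric.mem_cthickening_of_dist_le x y 1 _ (subset_tsupport _ hne)
          (by rwa [dist_comm]))
      refine ρ.dist_normed_convolution_le hui.1 fun y hy => ?_
      rw [h0 y ((Metric.mem_ball.1 hy).le.trans (min_le_right _ _)), h0 x (by simp), dist_self]
  have h2 : ∫⁻ x, ‖u x - smoothPush ν id (ρ.normed ν) u x‖ₑ ∂ν ≤ ε / 3 := by
    refine (lintegral_mono hpt).trans ?_
    rw [lintegral_indicator_const hK.measurableSet]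
    exact hη.le
  have h3 : ∫⁻ x, ‖smoothPush ν id (ρ.normed ν) u x - smoothPush ν id (ρ.normed ν) g x‖ₑ ∂ν
      ≤ ε / 3 := by
    simp only [smoothPush_sub hui hg hid hρ.continuous hρc]
    refine (lintegral_enorm_smoothPush_le (hui.sub hg) hid hρ.continuous
      (lintegral_enorm_normed ρ ν)).trans ?_
    simpa only [Pi.sub_apply, enorm_sub_rev (u _)] using hgu
  have hsu := (contDiff_smoothPush hui hid hρ hρc).continuous
  calc ∫⁻ x, ‖g x - smoothPush ν id (ρ.normed ν) g x‖ₑ ∂ν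
      ≤ ∫⁻ x, (‖g x - u x‖ₑ + (‖u x - smoothPush ν id (ρ.normed ν) u x‖ₑ +
          ‖smoothPush ν id (ρ.normed ν) u x - smoothPush ν id (ρ.normed ν) g x‖ₑ)) ∂ν := by
        refine lintegral_mono fun x => ?_
        simp only [← edist_eq_enorm_sub]
        exact (edist_triangle _ (u x) _).trans (add_le_add_right (edist_triangle _ _ _) _)
    _ = ∫⁻ x, ‖g x - u x‖ₑ ∂ν + (∫⁻ x, ‖u x - smoothPush ν id (ρ.normed ν) u x‖ₑ ∂ν +
          ∫⁻ x, ‖smoothPush ν id (ρ.normed ν) u x - smoothPush ν id (ρ.normed ν) g x‖ₑ ∂ν) := by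
        rw [lintegral_add_left' (show AEMeasurable (fun x => ‖g x - u x‖ₑ) ν from
            (hg.1.sub hui.1).enorm),
          lintegral_add_left (hu.fun_sub hsu).measurable.enorm]
    _ ≤ ε / 3 + (ε / 3 + ε / 3) := add_le_add hgu (add_le_add h2 h3)
    _ = ε := by rw [← add_assoc, ENNReal.add_thirds]

end Smoothing

lemma fderiv_pi_apply {d : ℕ} {φ : (Fin d → ℝ) → (Fin d → ℝ)} (hφ : Differentiable ℝ φ)
    (y e : Fin d → ℝ) (j : Fin d) :
    fderiv ℝ φ y e j = fderiv ℝ (fun x => φ x j) y e := by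
  rw [(hasFDerivAt_pi'.1 (hφ y).hasFDerivAt j).fderiv]
  rfl

/-- The total variation of a pushed forward smooth density is attained by pairing the
original density with the divergence of a test field along `τ`. -/
lemma exists_isTest_sum_lintegral_enorm_fderiv_eq {d : ℕ} {Z : Type*} [MeasurableSpace Z]
    {μ : Measure Z} [SFinite μ] {τ : Z → Fin d → ℝ} {f : Z → ℝ} {Θ : (Fin d → ℝ) → ℝ}
    (hf : Integrable f μ) (hτ : AEStronglyMeasurable τ μ) (hΘ : ContDiff ℝ 1 Θ)
    (hΘc : HasCompactSupport Θ) (hΘneg : ∀ x, fderiv ℝ Θ (-x) = -fderiv ℝ Θ x)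
    (hΘ1 : ∫⁻ x, ‖Θ x‖ₑ = 1) (hwc : HasCompactSupport (smoothPush μ τ Θ f)) :
    ∃ φ, IsTest d φ ∧
      ∑ j, ∫⁻ x, ‖fderiv ℝ (smoothPush μ τ Θ f) x (Pi.single j 1)‖ₑ =
        ‖∫ z, f z * divg φ (τ z) ∂μ‖ₑ := by
  have hw := contDiff_smoothPush hf hτ hΘ hΘc
  set w := smoothPush μ τ Θ f with hw_def
  set D : Fin d → (Fin d → ℝ) → ℝ := fun j x => fderiv ℝ w x (Pi.single j 1) with hD
  have hDcont : ∀ j, Continuous (D j) := fun j =>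
    (hw.continuous_fderiv one_ne_zero).clm_apply continuous_const
  have hDc : ∀ j, HasCompactSupport (D j) := fun j => hwc.fderiv_apply ℝ _
  set s : Fin d → (Fin d → ℝ) → ℝ := fun j x => -(D j x / |D j x|) with hs
  have hs1 : ∀ j x, ‖s j x‖ ≤ 1 := fun j x => by
    simpa [hs, abs_div] using div_self_le_one (|D j x|)
  have hsD : ∀ j x, s j x * D j x = -|D j x| := fun j x => by
    rcases eq_or_ne (D j x) 0 with h | h
    · simp [hs, h]
    · simp only [hs]
      field_simp
      simp
  have hsm : ∀ j, Measurable (s j) := fun j =>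
    ((hDcont j).measurable.div (hDcont j).abs.measurable).neg
  have hs0 : ∀ j x, s j x ≠ 0 → x ∈ tsupport (D j) := fun j x hx =>
    subset_tsupport _ fun h => hx (by simp [hs, h])
  have hsi : ∀ j, Integrable (s j) := fun j => by
    have h1 : IntegrableOn (s j) (tsupport (D j)) :=
      Measure.integrableOn_of_bounded (hDc j).isCompact.measure_lt_top.ne
        (hsm j).aestronglyMeasurable (M := 1) (ae_of_all _ (hs1 j))
    exact (integrableOn_iff_integrable_of_support_subset fun x hx => hs0 j x hx).1 h1
  have hid : AEStronglyMeasurable (id : (Fin d → ℝ) → (Fin d → ℝ)) volume :=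
    aestronglyMeasurable_id
  set φ : (Fin d → ℝ) → (Fin d → ℝ) := fun y j => smoothPush volume id Θ (s j) y with hφ
  have hφj : ∀ j, ContDiff ℝ 1 fun y => φ y j := fun j => contDiff_smoothPush (hsi j) hid hΘ hΘc
  have hφC : ContDiff ℝ 1 φ := contDiff_pi.2 hφj
  have hφjc : ∀ j, HasCompactSupport fun y => φ y j := fun j =>
    hasCompactSupport_smoothPush (hDc j).isCompact (ae_of_all _ (hs0 j)) hΘc
  have hφc : HasCompactSupport φ := by
    refine HasCompactSupport.intro (isCompact_iUnion fun j => (hφjc j).isCompact) fun x hx => ?_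
    ext j
    exact image_eq_zero_of_notMem_tsupport (f := fun y => φ y j)
      fun h => hx (mem_iUnion.2 ⟨j, h⟩)
  have hφ1 : ∀ y, ‖φ y‖ ≤ 1 := fun y => by
    refine (pi_norm_le_iff_of_nonneg zero_le_one).2 fun j => ?_
    rw [← ENNReal.ofReal_le_ofReal_iff zero_le_one, ofReal_norm, ENNReal.ofReal_one]
    calc ‖φ y j‖ₑ ≤ ∫⁻ x, ‖s j x * Θ (y - id x)‖ₑ := enorm_integral_le_lintegral_enorm _
      _ ≤ ∫⁻ x, ‖Θ (y - x)‖ₑ := by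
          refine lintegral_mono fun x => ?_
          rw [enorm_mul]
          refine mul_le_of_le_one_left' ?_
          rw [← ofReal_norm, ENNReal.ofReal_le_one]
          exact hs1 j x
      _ = 1 := by rw [lintegral_sub_left_eq_self (fun x => ‖Θ x‖ₑ), hΘ1]
  refine ⟨φ, ⟨hφC, hφc, hφ1⟩, ?_⟩
  have hdiv : ∀ y, divg φ y = ∑ j, fderiv ℝ (fun x => φ x j) y (Pi.single j 1) := fun y =>
    Finset.sum_congr rfl fun j _ => fderiv_pi_apply (hφC.differentiable one_ne_zero) _ _ _
  have hintegrable : ∀ j, Integrable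
      (fun z => f z * fderiv ℝ (fun x => φ x j) (τ z) (Pi.single j 1)) μ := fun j => by
    have hc : Continuous fun y => fderiv ℝ (fun x => φ x j) y (Pi.single j 1) :=
      ((hφj j).continuous_fderiv one_ne_zero).clm_apply continuous_const
    obtain ⟨M, hM⟩ := ((hφjc j).fderiv_apply ℝ (Pi.single j 1)).exists_bound_of_continuous hc
    exact hf.mul_bdd (c := M) (hc.comp_aestronglyMeasurable hτ) (ae_of_all _ fun z => hM _)
  have hpair : ∀ j, ∫ z, f z * fderiv ℝ (fun x => φ x j) (τ z) (Pi.single j 1) ∂μ =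
      ∫ x, |D j x| := fun j => by
    have hc : Continuous fun y => fderiv ℝ Θ y (Pi.single j 1) :=
      (hΘ.continuous_fderiv one_ne_zero).clm_apply continuous_const
    obtain ⟨M, hM⟩ := (hΘc.fderiv_apply ℝ (Pi.single j 1)).exists_bound_of_continuous hc
    have hF : Integrable (Function.uncurry fun z x =>
        f z * s j x * fderiv ℝ Θ (τ z - x) (Pi.single j 1)) (μ.prod volume) :=
      (hf.mul_prod (hsi j)).mul_bdd (c := M) (hc.comp_aestronglyMeasurable
        (hτ.comp_fst.sub measurable_snd.aestronglyMeasurable)) (ae_of_all _ fun z => hM _)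
    calc ∫ z, f z * fderiv ℝ (fun x => φ x j) (τ z) (Pi.single j 1) ∂μ
        = ∫ z, (∫ x, f z * s j x * fderiv ℝ Θ (τ z - x) (Pi.single j 1)) ∂μ := by
          refine integral_congr_ae (ae_of_all _ fun z => ?_)
          simp only [hφ, fderiv_smoothPush_apply (hsi j) hid hΘ hΘc, mul_assoc, id,
            integral_const_mul]
      _ = ∫ x, (∫ z, f z * s j x * fderiv ℝ Θ (τ z - x) (Pi.single j 1) ∂μ) :=
          integral_integral_swap hF
      _ = ∫ x, |D j x| := by
          refine integral_congr_ae (ae_of_all _ fun x => ?_)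
          have h1 : ∀ z, f z * s j x * fderiv ℝ Θ (τ z - x) (Pi.single j 1) =
              -s j x * (f z * fderiv ℝ Θ (x - τ z) (Pi.single j 1)) := fun z => by
            rw [← neg_sub x (τ z), hΘneg, neg_apply]
            ring
          simp only [h1, integral_const_mul]
          rw [← fderiv_smoothPush_apply hf hτ hΘ hΘc, ← hw_def, neg_mul, hsD, neg_neg]
  simp only [hdiv, Finset.mul_sum]
  rw [integral_finsetSum _ fun j _ => hintegrable j, Finset.sum_congr rfl fun j _ => hpair j,
    Real.enorm_of_nonneg (Finset.sum_nonneg fun j _ => integral_nonneg fun x => abs_nonneg _),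
    ENNReal.ofReal_sum_of_nonneg fun j _ => integral_nonneg fun x => abs_nonneg _]
  refine Finset.sum_congr rfl fun j _ => ?_
  rw [ofReal_integral_eq_lintegral_ofReal ((hDcont j).integrable_of_hasCompactSupport (hDc j)).abs
    (ae_of_all _ fun x => abs_nonneg _)]
  exact lintegral_congr fun x => Real.enorm_eq_ofReal_abs _

lemma exists_mem_le_of_contracting {P : Set ℝ≥0∞} {σ C : ℝ≥0} (hσ : σ < 1)
    (hfin : ∃ x ∈ P, x ≠ ⊤) (hstep : ∀ x ∈ P, ∃ y ∈ P, y ≤ σ * x + C) :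
    ∃ x ∈ P, x ≤ (((σ + C) / (1 - σ) + 1 : ℝ≥0) : ℝ≥0∞) := by
  obtain ⟨x₀, hx₀, hx₀t⟩ := hfin
  have hbt : sInf P ≠ ⊤ := ((sInf_le hx₀).trans_lt hx₀t.lt_top).ne
  obtain ⟨b, hb⟩ : ∃ b : ℝ≥0, (b : ℝ≥0∞) = sInf P := ⟨_, ENNReal.coe_toNNReal hbt⟩
  obtain ⟨x, hx, hxb⟩ := sInf_lt_iff.1 (ENNReal.lt_add_right hbt one_ne_zero)
  refine ⟨x, hx, hxb.le.trans ?_⟩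
  obtain ⟨y, hy, hyx⟩ := hstep x hx
  have h1 : (b : ℝ≥0∞) ≤ σ * (b + 1) + C := by
    rw [hb]
    exact (sInf_le hy).trans (hyx.trans (by gcongr))
  have h2 : b ≤ σ * (b + 1) + C := by exact_mod_cast h1
  have h3 : b ≤ (σ + C) / (1 - σ) := by
    rw [le_div_iff₀ (tsub_pos_of_lt hσ), ← NNReal.coe_le_coe]
    have h4 := NNReal.coe_le_coe.2 h2
    push_cast [NNReal.coe_sub hσ.le] at h4 ⊢
    linarith
  rw [← hb]
  exact_mod_cast add_le_add_left h3 1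

lemma integrable_of_hasCompactSupport_of_contDiff {d : ℕ} {v : (Fin d → ℝ) → ℝ}
    (hv : ContDiff ℝ 1 v) (hvc : HasCompactSupport v) : Integrable v :=
  hv.continuous.integrable_of_hasCompactSupport hvc

lemma continuous_divg {d : ℕ} {φ : (Fin d → ℝ) → (Fin d → ℝ)} (hφ : ContDiff ℝ 1 φ) :
    Continuous (divg φ) :=
  continuous_finsetSum _ fun j _ => (continuous_apply j).comp
    ((hφ.continuous_fderiv one_ne_zero).clm_apply continuous_const)

lemma hasCompactSupport_divg {d : ℕ} {φ : (Fin d → ℝ) → (Fin d → ℝ)}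
    (hφc : HasCompactSupport φ) : HasCompactSupport (divg φ) :=
  HasCompactSupport.intro (hφc.fderiv ℝ).isCompact fun x hx => by
    simp [divg, image_eq_zero_of_notMem_tsupport hx]

/-- For smooth densities the pairing with a test field is bounded by the total variation. -/
lemma enorm_integral_mul_divg_le {d : ℕ} {φ : (Fin d → ℝ) → (Fin d → ℝ)} (hφ : IsTest d φ)
    {v : (Fin d → ℝ) → ℝ} (hv : ContDiff ℝ 1 v) (hvc : HasCompactSupport v) :
    ‖∫ x, v x * divg φ x‖ₑ ≤ ∑ j, ∫⁻ x, ‖fderiv ℝ v x (Pi.single j 1)‖ₑ := by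
  have hφj : ∀ j, ContDiff ℝ 1 fun y => φ y j := fun j => contDiff_pi.1 hφ.1 j
  have hDφ : ∀ j, Continuous fun y => fderiv ℝ (fun y => φ y j) y (Pi.single j 1) := fun j =>
    ((hφj j).continuous_fderiv one_ne_zero).clm_apply continuous_const
  have hDv : ∀ j : Fin d, Continuous fun y => fderiv ℝ v y (Pi.single j 1) := fun j =>
    (hv.continuous_fderiv one_ne_zero).clm_apply continuous_const
  have i1 : ∀ j, Integrable fun x => v x * fderiv ℝ (fun y => φ y j) x (Pi.single j 1) :=
    fun j => (hv.continuous.mul (hDφ j)).integrable_of_hasCompactSupport hvc.mul_right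
  have hdiv : ∀ x, v x * divg φ x =
      ∑ j, v x * fderiv ℝ (fun y => φ y j) x (Pi.single j 1) := fun x => by
    rw [divg, Finset.mul_sum]
    exact Finset.sum_congr rfl fun j _ => by
      rw [fderiv_pi_apply (hφ.1.differentiable one_ne_zero)]
  simp only [hdiv]
  rw [integral_finsetSum _ fun j _ => i1 j]
  refine (enorm_sum_le _ _).trans (Finset.sum_le_sum fun j _ => ?_)
  rw [integral_mul_fderiv_eq_neg_fderiv_mul_of_integrable
    (((hDv j).mul (hφj j).continuous).integrable_of_hasCompactSupport
      (hvc.fderiv_apply ℝ _).mul_right) (i1 j)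
    ((hv.continuous.mul (hφj j).continuous).integrable_of_hasCompactSupport hvc.mul_right)
    (fun x _ => hv.differentiable one_ne_zero x)
    (fun x _ => (hφj j).differentiable one_ne_zero x), enorm_neg]
  refine (enorm_integral_le_lintegral_enorm _).trans (lintegral_mono fun x => ?_)
  rw [enorm_mul]
  refine mul_le_of_le_one_right' ?_
  rw [← ofReal_norm, ENNReal.ofReal_le_one]
  exact (norm_le_pi_norm (φ x) j).trans (hφ.2.2 x)

/-- An integrable function that is an `L¹`-limit of smooth densities with uniformly bounded
total variation has bounded variation. -/
lemma bvNormE_le_of_approx {d : ℕ} {g : (Fin d → ℝ) → ℝ} (hg : Integrable g) {R : ℝ≥0}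
    (happ : ∀ ε : ℝ≥0, 0 < ε → ε ≤ 1 → ∃ v : (Fin d → ℝ) → ℝ, ContDiff ℝ 1 v ∧
      HasCompactSupport v ∧ ∫⁻ x, ‖g x - v x‖ₑ < ε ∧
      ∑ j, ∫⁻ x, ‖fderiv ℝ v x (Pi.single j 1)‖ₑ ≤ R) : bvNormE g ≤ R := by
  refine iSup_le fun ⟨φ, hφ⟩ => ?_
  obtain ⟨M, hM⟩ := (hasCompactSupport_divg hφ.2.1).exists_bound_of_continuous
    (continuous_divg hφ.1)
  have hbd : ∀ ε : ℝ≥0, 0 < ε → ε ≤ 1 →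
      ENNReal.ofReal (∫ x, g x * divg φ x) ≤ R + ε * M.toNNReal := by
    intro ε hε hε1
    obtain ⟨v, hv, hvc, hgv, hR⟩ := happ ε hε hε1
    have hvi := integrable_of_hasCompactSupport_of_contDiff hv hvc
    have hsm := (continuous_divg hφ.1).aestronglyMeasurable (μ := volume)
    have i1 := (hg.sub hvi).mul_bdd hsm (ae_of_all _ hM)
    have i2 := hvi.mul_bdd hsm (ae_of_all _ hM)
    have hsplit : ∫ x, g x * divg φ x =
        (∫ x, v x * divg φ x) + ∫ x, (g - v) x * divg φ x := by
      rw [← integral_add i2 i1]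
      exact integral_congr_ae (ae_of_all _ fun x => by simp only [Pi.sub_apply]; ring)
    have h2 : ‖∫ x, (g - v) x * divg φ x‖ₑ ≤ ε * M.toNNReal := by
      refine (enorm_integral_le_lintegral_enorm _).trans ?_
      calc ∫⁻ x, ‖(g - v) x * divg φ x‖ₑ ≤ ∫⁻ x, ‖g x - v x‖ₑ * M.toNNReal := by
            refine lintegral_mono fun x => ?_
            rw [enorm_mul, Pi.sub_apply]
            gcongr
            rw [← ofReal_norm]
            exact ENNReal.ofReal_le_ofReal (hM x)
        _ = (∫⁻ x, ‖g x - v x‖ₑ) * M.toNNReal :=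
            lintegral_mul_const'' _ (hg.sub hvi).1.enorm
        _ ≤ ε * M.toNNReal := by gcongr
    calc ENNReal.ofReal (∫ x, g x * divg φ x) ≤ ‖∫ x, g x * divg φ x‖ₑ := by
          rw [← ofReal_norm]
          exact ENNReal.ofReal_le_ofReal (le_abs_self _)
      _ ≤ ‖∫ x, v x * divg φ x‖ₑ + ‖∫ x, (g - v) x * divg φ x‖ₑ := by
          rw [hsplit]; exact enorm_add_le _ _
      _ ≤ R + ε * M.toNNReal :=
          add_le_add ((enorm_integral_mul_divg_le hφ hv hvc).trans hR) h2
  refine ENNReal.le_of_forall_pos_le_add fun η hη _ => ?_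
  set m : ℝ≥0 := M.toNNReal
  have hpos : 0 < m + 1 := by positivity
  refine (hbd (min 1 (η / (m + 1))) (lt_min one_pos (div_pos hη hpos)) (min_le_left _ _)).trans ?_
  gcongr
  rw [← ENNReal.coe_mul, ENNReal.coe_le_coe]
  calc min 1 (η / (m + 1)) * m ≤ η / (m + 1) * (m + 1) := by
        gcongr
        · exact min_le_right _ _
        · exact le_self_add
    _ = η := div_mul_cancel₀ _ hpos.ne'

namespace PES

variable {d : ℕ} (S : PES d)

lemma aestronglyMeasurable_T : AEStronglyMeasurable S.T (volume.restrict S.Ω) :=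
  S.continuousOn_T.aestronglyMeasurable S.Ω_open.measurableSet

lemma ae_T_mem_Icc : ∀ᵐ z ∂volume.restrict S.Ω, S.T z ∈ Icc (0 : Fin d → ℝ) 1 := by
  filter_upwards [ae_restrict_mem S.Ω_open.measurableSet] with z hz
  exact closure_minimal S.Ω_subset isClosed_Icc (S.T_maps hz)

/-- Smooth approximations of an invariant density with uniformly bounded total variation. -/
theorem exists_smooth_approx {h : (Fin d → ℝ) → ℝ} (hL1 : IntegrableOn h S.Ω)
    (hinv : ∀ φ : (Fin d → ℝ) → ℝ, Measurable φ → (∃ M : ℝ, ∀ x, |φ x| ≤ M) →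
      ∫ x in S.Ω, φ (S.T x) * h x = ∫ x in S.Ω, φ x * h x) :
    ∃ R : ℝ≥0, ∀ ε : ℝ≥0, 0 < ε → ε ≤ 1 → ∃ v : (Fin d → ℝ) → ℝ, ContDiff ℝ 1 v ∧
      HasCompactSupport v ∧ ∫⁻ x, ‖S.Ω.indicator h x - v x‖ₑ < ε ∧
      ∑ j, ∫⁻ x, ‖fderiv ℝ v x (Pi.single j 1)‖ₑ ≤ R := by
  have hΩ := S.Ω_open.measurableSet
  set g := S.Ω.indicator h with hg_def
  have hg : Integrable g := (integrable_indicator_iff hΩ).2 hL1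
  obtain ⟨σ, B, hσ, hLY⟩ := S.exists_lasotaYorke
  set K : ℝ≥0∞ := ∫⁻ x, ‖g x‖ₑ with hK_def
  have hK : K ≠ ⊤ := hg.2.ne
  obtain ⟨C, hC⟩ : ∃ C : ℝ≥0, (C : ℝ≥0∞) = B * (K + 1) := ⟨_, ENNReal.coe_toNNReal
    (ENNReal.mul_ne_top ENNReal.coe_ne_top (ENNReal.add_ne_top.2 ⟨hK, ENNReal.one_ne_top⟩))⟩
  have hT := S.aestronglyMeasurable_T
  set N : ContDiffBump (0 : Fin d → ℝ) → ((Fin d → ℝ) → ℝ) → (Fin d → ℝ) → ℝ :=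
    fun ρ v => smoothPush (volume.restrict S.Ω) S.T (ρ.normed volume) v
  have hρ : ∀ ρ : ContDiffBump (0 : Fin d → ℝ), ContDiff ℝ 1 (ρ.normed volume) :=
    fun ρ => ρ.contDiff_normed
  have hρc : ∀ ρ : ContDiffBump (0 : Fin d → ℝ), HasCompactSupport (ρ.normed volume) :=
    fun ρ => ρ.hasCompactSupport_normed
  have hNC : ∀ ρ v, IntegrableOn v S.Ω → ContDiff ℝ 1 (N ρ v) := fun ρ v hv =>
    contDiff_smoothPush hv hT (hρ ρ) (hρc ρ)
  have hNc : ∀ ρ v, HasCompactSupport (N ρ v) := fun ρ v =>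
    hasCompactSupport_smoothPush isCompact_Icc (S.ae_T_mem_Icc.mono fun z hz _ => hz) (hρc ρ)
  have hNh : ∀ ρ x, N ρ h x = smoothPush volume id (ρ.normed volume) g x := by
    intro ρ x
    have hcont : Continuous fun y => ρ.normed volume (x - y) :=
      (hρ ρ).continuous.comp (continuous_const.sub continuous_id)
    obtain ⟨M, hM⟩ := (hρc ρ).exists_bound_of_continuous (hρ ρ).continuous
    have h1 := hinv _ hcont.measurable ⟨M, fun y => hM _⟩
    calc N ρ h x = ∫ z in S.Ω, ρ.normed volume (x - S.T z) * h z :=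
          integral_congr_ae (ae_of_all _ fun z => mul_comm _ _)
      _ = ∫ z in S.Ω, ρ.normed volume (x - z) * h z := h1
      _ = ∫ z, S.Ω.indicator (fun z => ρ.normed volume (x - z) * h z) z :=
          (integral_indicator hΩ).symm
      _ = smoothPush volume id (ρ.normed volume) g x := by
          refine integral_congr_ae (ae_of_all _ fun z => ?_)
          by_cases hz : z ∈ S.Ω <;> simp [hg_def, hz, mul_comm]
  have hDfin : ∀ v : (Fin d → ℝ) → ℝ, ContDiff ℝ 1 v → HasCompactSupport v →
      ∑ j, ∫⁻ x, ‖fderiv ℝ v x (Pi.single j 1)‖ₑ ≠ ⊤ := fun v hv hvc =>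
    ENNReal.sum_ne_top.2 fun j _ => ((((hv.continuous_fderiv one_ne_zero).clm_apply
      continuous_const).integrable_of_hasCompactSupport (hvc.fderiv_apply ℝ _)).2).ne
  refine ⟨(σ + C) / (1 - σ) + 1, fun ε hε hε1 => ?_⟩
  have hε0 : (0 : ℝ≥0∞) < ε := ENNReal.coe_pos.2 hε
  suffices h : ∃ x ∈ (fun v : (Fin d → ℝ) → ℝ => ∑ j, ∫⁻ x, ‖fderiv ℝ v x (Pi.single j 1)‖ₑ) ''
      {v | ContDiff ℝ 1 v ∧ HasCompactSupport v ∧ ∫⁻ x, ‖g x - v x‖ₑ < ε},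
      x ≤ (((σ + C) / (1 - σ) + 1 : ℝ≥0) : ℝ≥0∞) by
    obtain ⟨_, ⟨v, ⟨hv, hvc, hgv⟩, rfl⟩, hle⟩ := h
    exact ⟨v, hv, hvc, hgv, hle⟩
  refine exists_mem_le_of_contracting hσ ?_ ?_
  · obtain ⟨r, hr0, hr⟩ := ENNReal.lt_iff_exists_nnreal_btwn.1 hε0
    obtain ⟨ρ, hρle⟩ := exists_lintegral_sub_smoothPush_le hg hr0.ne'
    simp only [← hNh] at hρle
    exact ⟨_, ⟨N ρ h, ⟨hNC ρ h hL1, hNc ρ h, hρle.trans_lt hr⟩, rfl⟩,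
      hDfin _ (hNC ρ h hL1) (hNc ρ h)⟩
  · rintro _ ⟨v, ⟨hv, hvc, hgv⟩, rfl⟩
    have hvi := integrable_of_hasCompactSupport_of_contDiff hv hvc
    obtain ⟨r, hr0, hr⟩ := ENNReal.lt_iff_exists_add_pos_lt.1 hgv
    obtain ⟨ρ, hρle⟩ := exists_lintegral_sub_smoothPush_le hg (ENNReal.coe_pos.2 hr0).ne'
    simp only [← hNh] at hρle
    have hwC := hNC ρ v hvi.integrableOn
    have hNhC := hNC ρ h hL1
    have hclose : ∫⁻ x, ‖N ρ h x - N ρ v x‖ₑ ≤ ∫⁻ x, ‖g x - v x‖ₑ := by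
      simp only [N, smoothPush_sub hL1 hvi.integrableOn hT (hρ ρ).continuous (hρc ρ)]
      refine (lintegral_enorm_smoothPush_le (hL1.sub hvi.integrableOn) hT (hρ ρ).continuous
        (lintegral_enorm_normed ρ volume)).trans ?_
      refine le_trans (le_of_eq ?_) (setLIntegral_le_lintegral S.Ω _)
      exact setLIntegral_congr_fun hΩ fun x hx => by simp [hg_def, hx]
    refine ⟨_, ⟨N ρ v, ⟨hwC, hNc ρ v, ?_⟩, rfl⟩, ?_⟩
    · calc ∫⁻ x, ‖g x - N ρ v x‖ₑ
          ≤ ∫⁻ x, (‖g x - N ρ h x‖ₑ + ‖N ρ h x - N ρ v x‖ₑ) :=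
            lintegral_mono fun x => by
              simp only [← edist_eq_enorm_sub]
              exact edist_triangle _ _ _
        _ = (∫⁻ x, ‖g x - N ρ h x‖ₑ) + ∫⁻ x, ‖N ρ h x - N ρ v x‖ₑ :=
            lintegral_add_right _ (hNhC.continuous.fun_sub hwC.continuous).measurable.enorm
        _ ≤ r + ∫⁻ x, ‖g x - v x‖ₑ := add_le_add hρle hclose
        _ < ε := by rwa [add_comm]
    · obtain ⟨φ, hφ, hφeq⟩ := exists_isTest_sum_lintegral_enorm_fderiv_eq hvi.integrableOn hT
        (hρ ρ) (hρc ρ) (fderiv_normed_neg ρ volume) (lintegral_enorm_normed ρ volume) (hNc ρ v)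
      simp only [N]
      rw [hφeq, hC]
      refine (hLY φ hφ v hv hvc).trans ?_
      gcongr
      calc ∫⁻ z, ‖v z‖ₑ ≤ ∫⁻ z, (‖g z‖ₑ + ‖g z - v z‖ₑ) := lintegral_mono fun z => by
            simpa using enorm_sub_le (a := g z) (b := g z - v z)
        _ = K + ∫⁻ z, ‖g z - v z‖ₑ := lintegral_add_left' hg.1.enorm _
        _ ≤ K + 1 := by
            gcongr
            exact hgv.le.trans (by exact_mod_cast hε1)

end PES

theorem statement1 {d : ℕ} (hd : 1 ≤ d) (S : PES d) (h : (Fin d → ℝ) → ℝ)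
    (hL1 : MeasureTheory.IntegrableOn h S.Ω volume)
    (hpos : ∀ x, 0 ≤ h x) (hone : ∫ x in S.Ω, h x = 1)
    (hinv : ∀ φ : (Fin d → ℝ) → ℝ, Measurable φ → (∃ M : ℝ, ∀ x, |φ x| ≤ M) →
      ∫ x in S.Ω, φ (S.T x) * h x = ∫ x in S.Ω, φ x * h x) :
    ∃ g : (Fin d → ℝ) → ℝ, MemBVOn S.Ω g ∧ h =ᵐ[volume.restrict S.Ω] g := by
  obtain ⟨R, hR⟩ := S.exists_smooth_approx hL1 hinv
  have hg : Integrable (S.Ω.indicator h) := (integrable_indicator_iff S.Ω_open.measurableSet).2 hL1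
  exact ⟨h, ⟨hg, (bvNormE_le_of_approx hg hR).trans_lt ENNReal.coe_lt_top⟩, ae_eq_rfl⟩

end Liverani
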